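/- arXiv:1911.10032 — 5 statements merged into one kernel-verified Lean document; each statement's English description precedes it below -/
import Mathlib

section
/- Let 0 < s < d and let E ⊆ ℝ^d be a Borel set that is mid-point convex and satisfies 0 < H^s(E) < ∞. Then H^s(convexHull E) = H^s(E); in particular 0 < H^s(convexHull E) < ∞. -/
open MeasureTheory Set Metric Filter
open scoped ENNReal

/-- A set `E ⊆ ℝ^d` is mid-point convex if the midpoint of any two of its points
belongs to it. -/
def MidpointConvexSet {d : ℕ} (E : Set (EuclideanSpace ℝ (Fin d))) : Prop :=
  ∀ x ∈ E, ∀ y ∈ E, midpoint ℝ x y ∈ E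

/-- A set `E ⊆ ℝ^d` is essentially convex if there are an integer `1 ≤ s ≤ d` and an affine
subspace `L` of dimension `s` containing `E` such that, in the subspace topology of `L`,
`E` has nonempty interior and `convexHull E \ E` lies in the frontier of `convexHull E`. -/
def EssentiallyConvex {d : ℕ} (E : Set (EuclideanSpace ℝ (Fin d))) : Prop :=
  ∃ s : ℕ, 1 ≤ s ∧ s ≤ d ∧
    ∃ L : AffineSubspace ℝ (EuclideanSpace ℝ (Fin d)),
      Module.finrank ℝ L.direction = s ∧
      E ⊆ (L : Set (EuclideanSpace ℝ (Fin d))) ∧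
      (interior ((Subtype.val : L → EuclideanSpace ℝ (Fin d)) ⁻¹' E)).Nonempty ∧
      (Subtype.val : L → EuclideanSpace ℝ (Fin d)) ⁻¹' (convexHull ℝ E \ E) ⊆
        frontier ((Subtype.val : L → EuclideanSpace ℝ (Fin d)) ⁻¹' (convexHull ℝ E))


open scoped Topology Pointwise

/-- A closed set that contains the midpoints of its points is convex. -/
theorem IsClosed.convex_of_midpoint_mem {V : Type*} [NormedAddCommGroup V] [NormedSpace ℝ V]
    {C : Set V} (hC : IsClosed C) (hmid : ∀ x ∈ C, ∀ y ∈ C, midpoint ℝ x y ∈ C) :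
    Convex ℝ C := by
  rw [convex_iff_segment_subset]
  intro x hx y hy
  rw [segment_eq_image_lineMap]
  rintro _ ⟨t, ⟨ht0, ht1⟩, rfl⟩
  set T : Set ℝ := AffineMap.lineMap x y ⁻¹' C with hT
  have hTc : IsClosed T := hC.preimage AffineMap.lineMap_continuous
  have hTm : ∀ a ∈ T, ∀ b ∈ T, midpoint ℝ a b ∈ T := by
    intro a ha b hb
    simp only [hT, mem_preimage, AffineMap.map_midpoint] at ha hb ⊢
    exact hmid _ ha _ hb
  have h0 : (0 : ℝ) ∈ T := by simpa [hT] using hx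
  have h1 : (1 : ℝ) ∈ T := by simpa [hT] using hy
  obtain ⟨a, ⟨haT, ha0, hat⟩, hamax⟩ :=
    (isCompact_Icc.inter_left hTc : IsCompact (T ∩ Icc 0 t)).exists_isGreatest
      ⟨0, h0, le_rfl, ht0⟩
  obtain ⟨b, ⟨hbT, htb, hb1⟩, hbmin⟩ :=
    (isCompact_Icc.inter_left hTc : IsCompact (T ∩ Icc t 1)).exists_isLeast
      ⟨1, h1, ht1, le_rfl⟩
  have hm := hTm a haT b hbT
  have hmab : midpoint ℝ a b = (a + b) / 2 := by
    rw [midpoint_eq_smul_add, invOf_eq_inv, smul_eq_mul]; ring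
  rw [hmab] at hm
  change t ∈ T
  rcases le_total ((a + b) / 2) t with h | h
  · have := hamax ⟨hm, by linarith, h⟩
    have hta : t = b := by linarith
    rwa [hta]
  · have := hbmin ⟨hm, h, by linarith⟩
    have hta : t = a := by linarith
    rwa [hta]

/-- The closure of a set that contains the midpoints of its points is convex. -/
theorem convex_closure_of_midpoint_mem {V : Type*} [NormedAddCommGroup V] [NormedSpace ℝ V]
    {E : Set V} (hmid : ∀ x ∈ E, ∀ y ∈ E, midpoint ℝ x y ∈ E) : Convex ℝ (closure E) := by
  refine isClosed_closure.convex_of_midpoint_mem fun x hx y hy => ?_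
  refine map_mem_closure₂ (f := fun x y => midpoint ℝ x y) ?_ hx hy hmid
  simp only [midpoint_eq_smul_add]
  fun_prop

theorem lineMap_inv_two_pow_mem_of_midpoint_mem {V : Type*} [AddCommGroup V] [Module ℝ V]
    {E : Set V} (hmid : ∀ x ∈ E, ∀ y ∈ E, midpoint ℝ x y ∈ E) {x y : V}
    (hx : x ∈ E) (hy : y ∈ E) (n : ℕ) : AffineMap.lineMap x y ((2 : ℝ)⁻¹ ^ n) ∈ E := by
  induction n with
  | zero => simpa using hy
  | succ n ih =>
    convert hmid _ hx _ ih using 1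
    simp only [midpoint_eq_smul_add, AffineMap.lineMap_apply_module, invOf_eq_inv, pow_succ]
    module

/-- A set containing the midpoints of its points and having nonempty interior contains the
interior of its closure. -/
theorem interior_closure_subset_of_midpoint_mem {V : Type*} [NormedAddCommGroup V]
    [NormedSpace ℝ V] {E : Set V} (hmid : ∀ x ∈ E, ∀ y ∈ E, midpoint ℝ x y ∈ E)
    (hint : (interior E).Nonempty) : interior (closure E) ⊆ E := by
  intro z hz
  obtain ⟨b, hb⟩ := hint
  have hε : Tendsto (fun n : ℕ => (2 : ℝ)⁻¹ ^ n) atTop (𝓝 0) :=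
    tendsto_pow_atTop_nhds_zero_of_lt_one (by norm_num) (by norm_num)
  -- the point `w` with `z = lineMap w b (2⁻¹ ^ n)` lies in the closure of `E` for large `n`
  have hw : Tendsto (fun n : ℕ => (1 - (2 : ℝ)⁻¹ ^ n)⁻¹ • (z - (2 : ℝ)⁻¹ ^ n • b)) atTop
      (𝓝 ((1 - (0 : ℝ))⁻¹ • (z - (0 : ℝ) • b))) :=
    ((tendsto_const_nhds.sub hε).inv₀ (by norm_num)).smul
      (tendsto_const_nhds.sub (hε.smul_const b))
  simp only [sub_zero, inv_one, zero_smul, one_smul] at hw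
  obtain ⟨n, hn, hn1⟩ := ((hw.eventually (mem_interior_iff_mem_nhds.1 hz)).and
    (eventually_ge_atTop 1)).exists
  set δ : ℝ := (2 : ℝ)⁻¹ ^ n with hδ
  have hδ0 : 0 < δ := by positivity
  have hδ1 : δ < 1 := pow_lt_one₀ (by norm_num) (by norm_num) (by omega)
  have hδ1' : 1 - δ ≠ 0 := by linarith
  set w := (1 - δ)⁻¹ • (z - δ • b) with hwdef
  -- for `x` near `w`, the solution `y` of `z = lineMap x y δ` is near `b`
  have hcont : Continuous fun x : V => δ⁻¹ • (z - (1 - δ) • x) := by fun_prop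
  have hwb : δ⁻¹ • (z - (1 - δ) • w) = b := by
    rw [hwdef, smul_inv_smul₀ hδ1', sub_sub_cancel, inv_smul_smul₀ hδ0.ne']
  have hnear : ∀ᶠ x in 𝓝 w, δ⁻¹ • (z - (1 - δ) • x) ∈ E := by
    refine hcont.continuousAt.eventually ?_
    simp only [hwb]
    exact mem_interior_iff_mem_nhds.1 hb
  obtain ⟨x, hxE, hyE⟩ := (mem_closure_iff_frequently.1 hn).and_eventually hnear |>.exists
  have := lineMap_inv_two_pow_mem_of_midpoint_mem hmid hxE hyE n
  rwa [← hδ, AffineMap.lineMap_apply_module, smul_inv_smul₀ hδ0.ne', add_sub_cancel] at this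

/-- The measure of the translates of a compact set is an upper semicontinuous function of the
translation vector. -/
theorem isClosed_setOf_le_measure_image_add {V : Type*} [NormedAddCommGroup V]
    [MeasurableSpace V] [BorelSpace V] (μ : Measure V) [IsFiniteMeasure μ] {K : Set V}
    (hK : IsCompact K) (c : ℝ≥0∞) : IsClosed {v : V | c ≤ μ ((fun x => v + x) '' K)} := by
  rw [← isOpen_compl_iff, isOpen_iff_mem_nhds]
  intro v hv
  obtain ⟨U, hKU, hU, hμU⟩ := ((fun x => v + x) '' K).exists_isOpen_lt_of_lt (μ := μ) c
    (not_le.1 hv)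
  have h : ∀ᶠ w in 𝓝 v, ∀ x ∈ K, w + x ∈ U := by
    refine hK.eventually_forall_of_forall_eventually fun x hx => ?_
    exact (continuous_add.tendsto (v, x)).eventually (hU.mem_nhds (hKU ⟨x, hx, rfl⟩))
  filter_upwards [h] with w hw
  refine not_le.2 (lt_of_le_of_lt (measure_mono ?_) hμU)
  rintro _ ⟨x, hx, rfl⟩
  exact hw x hx

/-- The average of the measures of the translates of a set. -/
theorem lintegral_measure_preimage_sub {V : Type*} [AddCommGroup V] [MeasurableSpace V]
    [MeasurableAdd₂ V] [MeasurableNeg V] (μ ν : Measure V) [SFinite μ] [SFinite ν]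
    [ν.IsAddLeftInvariant] [ν.IsNegInvariant] {B : Set V} (hB : MeasurableSet B) :
    ∫⁻ v, μ {x | x - v ∈ B} ∂ν = ν B * μ univ := by
  have hS : MeasurableSet {p : V × V | p.1 - p.2 ∈ B} :=
    (measurable_fst.sub measurable_snd) hB
  have h1 := Measure.prod_apply (μ := μ) (ν := ν) hS
  have h2 := Measure.prod_apply_symm (μ := μ) (ν := ν) hS
  change _ = ∫⁻ v, μ {x | x - v ∈ B} ∂ν at h2
  rw [← h2, h1]
  have h3 : ∀ x : V, ν (Prod.mk x ⁻¹' {p : V × V | p.1 - p.2 ∈ B}) = ν B := by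
    intro x
    exact (Measure.measurePreserving_sub_left ν x).measure_preimage hB.nullMeasurableSet
  simp only [h3, lintegral_const]

/-- A measurable set of positive Haar measure containing the midpoints of its points has nonempty
interior. -/
theorem interior_nonempty_of_midpoint_mem {V : Type*} [NormedAddCommGroup V] [NormedSpace ℝ V]
    [FiniteDimensional ℝ V] [MeasurableSpace V] [BorelSpace V] (ν : Measure V)
    [ν.IsAddHaarMeasure] {E : Set V} (hE : MeasurableSet E)
    (hmid : ∀ x ∈ E, ∀ y ∈ E, midpoint ℝ x y ∈ E) (hpos : ν E ≠ 0) :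
    (interior E).Nonempty := by
  obtain ⟨z, hz⟩ : ∃ z, ν.restrict E {x | x - z ∈ -E} ≠ 0 := by
    by_contra! h
    have := lintegral_measure_preimage_sub (ν.restrict E) ν hE.neg
    simp only [h, lintegral_zero, Measure.measure_neg, Measure.restrict_apply_univ] at this
    exact mul_ne_zero hpos hpos this.symm
  set L : Set V := {x | x - z ∈ -E} ∩ E with hL
  have hLm : MeasurableSet L := ((measurable_id.sub_const z) hE.neg).inter hE
  rw [Measure.restrict_apply' hE] at hz
  have hnhds : L - L ∈ 𝓝 (0 : V) :=
    Measure.sub_mem_nhds_zero_of_addHaar_pos ν L hLm (pos_iff_ne_zero.2 hz)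
  refine ⟨(2 : ℝ)⁻¹ • z, mem_interior_iff_mem_nhds.2 ?_⟩
  have hcont : Continuous fun p : V => (2 : ℝ) • p - z := by fun_prop
  have h0 : (2 : ℝ) • ((2 : ℝ)⁻¹ • z) - z = 0 := by
    rw [smul_inv_smul₀ two_ne_zero, sub_self]
  have hev : ∀ᶠ p in 𝓝 ((2 : ℝ)⁻¹ • z), (2 : ℝ) • p - z ∈ L - L :=
    hcont.continuousAt.eventually (by simp only [h0]; exact hnhds)
  filter_upwards [hev] with p hp
  obtain ⟨a, ha, b, hb, hab⟩ := hp
  have hb' : z - b ∈ E := by simpa using hb.1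
  convert hmid a ha.2 _ hb' using 1
  rw [midpoint_eq_smul_add, invOf_eq_inv, eq_inv_smul_iff₀ two_ne_zero]
  have hab' : a - b = (2 : ℝ) • p - z := hab
  rw [eq_sub_iff_add_eq] at hab'
  rw [← hab']
  abel

/-- A measurable set spanning the space, containing the midpoints of its points and having positive
and finite Hausdorff measure of some positive dimension, has positive Haar measure. -/
theorem addHaar_ne_zero_of_midpoint_mem {V : Type*} [NormedAddCommGroup V] [NormedSpace ℝ V]
    [FiniteDimensional ℝ V] [MeasurableSpace V] [BorelSpace V] (ν : Measure V)
    [ν.IsAddHaarMeasure] {s : ℝ} (hs : 0 ≤ s) {E : Set V} (hE : MeasurableSet E)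
    (hmid : ∀ x ∈ E, ∀ y ∈ E, midpoint ℝ x y ∈ E) (hspan : affineSpan ℝ E = ⊤)
    (hpos : 0 < μH[s] E) (hfin : μH[s] E < ∞) : ν E ≠ 0 := by
  intro hνE
  set μ : Measure V := μH[s].restrict E with hμ
  have : IsFiniteMeasure μ := ⟨by simpa [hμ] using hfin⟩
  obtain ⟨K, hKE, hK, hμK⟩ := hE.exists_lt_isCompact (μ := μ) (r := 0) (by simpa [hμ] using hpos)
  have hK0 : 0 < μH[s] K := hμK.trans_le (Measure.restrict_apply_le _ _)
  set K' : Set V := (fun x => (2 : ℝ)⁻¹ • x) '' K with hK'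
  have hK'c : IsCompact K' := hK.image (continuous_const_smul _)
  set c := μH[s] K' with hc
  have hc0 : 0 < c := by
    rw [hc, hK', image_smul, Measure.hausdorffMeasure_smul₀ hs (by norm_num)]
    refine pos_iff_ne_zero.2 (smul_ne_zero ?_ hK0.ne')
    exact (NNReal.rpow_pos (by simp)).ne'
  have hsub : (fun v : V => (2 : ℝ) • v) ⁻¹' closure E ⊆
      {v : V | c ≤ μ ((fun x => v + x) '' K')} := by
    have hcl := isClosed_setOf_le_measure_image_add μ hK'c c
    have hsub' : closure E ⊆ (fun v : V => (2 : ℝ)⁻¹ • v) ⁻¹'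
        {v : V | c ≤ μ ((fun x => v + x) '' K')} := by
      refine closure_minimal (fun v hv => ?_) (hcl.preimage (continuous_const_smul _))
      have hvE : (fun x => (2 : ℝ)⁻¹ • v + x) '' K' ⊆ E := by
        rintro _ ⟨_, ⟨x, hx, rfl⟩, rfl⟩
        have := hmid v hv x (hKE hx)
        rwa [midpoint_eq_smul_add, invOf_eq_inv, smul_add] at this
      change c ≤ μ _
      rw [hμ, Measure.restrict_apply', inter_eq_left.2 hvE,
        (isometry_add_left ((2 : ℝ)⁻¹ • v)).hausdorffMeasure_image (Or.inl hs)]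
      exact hE
    intro v hv
    simpa using hsub' hv
  have hνU : ν ((fun v : V => (2 : ℝ) • v) ⁻¹' closure E) ≠ 0 := by
    have hint : (interior (closure E)).Nonempty := by
      rw [(convex_closure_of_midpoint_mem hmid).interior_nonempty_iff_affineSpan_eq_top]
      exact top_le_iff.1 (hspan ▸ affineSpan_mono ℝ subset_closure)
    rw [Measure.addHaar_preimage_smul ν two_ne_zero]
    refine mul_ne_zero (by simp) ?_
    exact (Measure.measure_pos_of_nonempty_interior ν hint).ne'
  have hνK : ν K' = 0 := by
    rw [hK', image_smul, Measure.addHaar_smul, measure_mono_null hKE hνE, mul_zero]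
  have hF := lintegral_measure_preimage_sub μ ν hK'c.measurableSet
  have hS : MeasurableSet {p : V × V | p.1 - p.2 ∈ K'} :=
    (measurable_fst.sub measurable_snd) hK'c.measurableSet
  have hmeas : Measurable fun v => μ {x | x - v ∈ K'} := measurable_measure_prodMk_right hS
  rw [hνK, zero_mul, lintegral_eq_zero_iff hmeas] at hF
  refine hνU (measure_mono_null (fun v hv => ?_) (ae_iff.1 hF))
  have himage : (fun x => v + x) '' K' = {x | x - v ∈ K'} := by
    ext x
    simp [sub_eq_neg_add]
  have hlt := hc0.trans_le (hsub hv)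
  rw [himage] at hlt
  exact hlt.ne'

/-- The full-dimensional case of `hausdorffMeasure_convexHull_eq_of_midpointConvex`. -/
theorem hausdorffMeasure_convexHull_of_affineSpan_eq_top {V : Type*} [NormedAddCommGroup V]
    [InnerProductSpace ℝ V] [FiniteDimensional ℝ V] [MeasurableSpace V] [BorelSpace V]
    {s : ℝ} (hs : 0 ≤ s) {E : Set V} (hE : MeasurableSet E)
    (hmid : ∀ x ∈ E, ∀ y ∈ E, midpoint ℝ x y ∈ E) (hspan : affineSpan ℝ E = ⊤)
    (hpos : 0 < μH[s] E) (hfin : μH[s] E < ∞) : μH[s] (convexHull ℝ E) = μH[s] E := by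
  set ν : Measure V := μH[Module.finrank ℝ V] with hν
  have hνE : ν E ≠ 0 := addHaar_ne_zero_of_midpoint_mem ν hs hE hmid hspan hpos hfin
  have hks : (Module.finrank ℝ V : ℝ) ≤ s := by
    by_contra! h
    exact (Measure.hausdorffMeasure_zero_or_top h E).elim hνE hfin.ne
  have hsub : convexHull ℝ E ⊆ E ∪ frontier (closure E) := by
    intro x hx
    have hx' : x ∈ closure E :=
      convexHull_min subset_closure (convex_closure_of_midpoint_mem hmid) hx
    by_cases hxi : x ∈ interior (closure E)
    · exact Or.inl (interior_closure_subset_of_midpoint_mem hmid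
        (interior_nonempty_of_midpoint_mem ν hE hmid hνE) hxi)
    · exact Or.inr ⟨subset_closure hx', hxi⟩
  have hnull : μH[s] (frontier (closure E)) = 0 :=
    le_antisymm ((Measure.hausdorffMeasure_mono hks _).trans
      ((convex_closure_of_midpoint_mem hmid).addHaar_frontier ν).le) zero_le
  refine le_antisymm ?_ (measure_mono (subset_convexHull ℝ E))
  calc μH[s] (convexHull ℝ E) ≤ μH[s] (E ∪ frontier (closure E)) := measure_mono hsub
    _ ≤ μH[s] E + μH[s] (frontier (closure E)) := measure_union_le _ _
    _ = μH[s] E := by rw [hnull, add_zero]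

theorem hausdorffMeasure_convexHull_eq_of_midpointConvex
    (d : ℕ) (s : ℝ) (hs : 0 < s) (hsd : s < d)
    (E : Set (EuclideanSpace ℝ (Fin d))) (hE : MeasurableSet E)
    (hmid : MidpointConvexSet E)
    (hpos : 0 < μH[s] E) (hfin : μH[s] E < ∞) :
    μH[s] (convexHull ℝ E) = μH[s] E ∧
      0 < μH[s] (convexHull ℝ E) ∧ μH[s] (convexHull ℝ E) < ∞ := by
  suffices h : μH[s] (convexHull ℝ E) = μH[s] E by rw [h]; exact ⟨rfl, hpos, hfin⟩
  obtain ⟨p, hp⟩ : E.Nonempty := nonempty_of_measure_ne_zero hpos.ne'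
  set W := vectorSpan ℝ E with hW
  let φ : W →ᵃ[ℝ] EuclideanSpace ℝ (Fin d) :=
    W.subtype.toAffineMap + AffineMap.const ℝ W p
  have hφ : ∀ w : W, φ w = w + p := fun w => by simp [φ]
  have hφi : Isometry φ := by
    refine Isometry.of_dist_eq fun a b => ?_
    rw [hφ, hφ, dist_add_right]; rfl
  set F : Set W := φ ⁻¹' E with hF
  have hFE : φ '' F = E := by
    refine image_preimage_eq_of_subset fun x hx => ?_
    exact ⟨⟨x - p, vsub_mem_vectorSpan ℝ hx hp⟩, by simp [hφ]⟩
  have hμ : ∀ A : Set W, μH[s] (φ '' A) = μH[s] A := fun A =>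
    hφi.hausdorffMeasure_image (Or.inl hs.le) A
  have hFspan : affineSpan ℝ F = ⊤ := by
    have h0 : (0 : W) ∈ F := by simpa [hF, hφ] using hp
    have : vectorSpan ℝ F = ⊤ := by
      apply Submodule.map_injective_of_injective W.injective_subtype
      have hlin : φ.linear = W.subtype := by simp [φ]
      rw [Submodule.map_top, Submodule.range_subtype, ← hlin, φ.map_vectorSpan, hFE]
    rw [AffineSubspace.affineSpan_eq_top_iff_vectorSpan_eq_top_of_nonempty ℝ _ _ ⟨0, h0⟩, this]
  have key := hausdorffMeasure_convexHull_of_affineSpan_eq_top hs.le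
    (hE.preimage hφi.continuous.measurable) (E := F)
    (fun x hx y hy => by
      change φ (midpoint ℝ x y) ∈ E
      rw [φ.map_midpoint]
      exact hmid _ hx _ hy) hFspan (by rwa [← hμ, hFE]) (by rwa [← hμ, hFE])
  rwa [← hμ, ← hμ, φ.image_convexHull, hFE] at key
end

section
/- Let (α_j)_{j≥1} be a non-decreasing sequence of real numbers in (0,1). Then there exists a compact set A ⊆ [0,1) such that for every j ≥ 1 the j-fold sumset A_j has Hausdorff dimension α_j, and moreover H^{α_1}(A) = ∞. -/
open MeasureTheory Set Filter
open scoped ENNReal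

/-- The `j`-fold sumset `A_j = {a₁ + ⋯ + a_j : a₁, …, a_j ∈ A}` of a set `A ⊆ ℝ`. -/
def sumSet (A : Set ℝ) (j : ℕ) : Set ℝ :=
  {x | ∃ f : Fin j → ℝ, (∀ i, f i ∈ A) ∧ ∑ i, f i = x}

open scoped NNReal Topology

theorem hausdorffMeasure_image_Ico_eq_top {a : ℝ} (ha : 0 < a) {g : ℝ → ℝ}
    (hg : MonotoneOn g (Ico 0 1))
    (h : ∀ ε > 0, ∃ η > 0, ∀ s ∈ Ico (0 : ℝ) 1, ∀ t ∈ Ico (0 : ℝ) 1, s < t →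
      g t - g s ≤ η → t - s ≤ ε * (g t - g s) ^ a) :
    μH[a] (g '' Ico 0 1) = ∞ := by
  refine ENNReal.eq_top_of_forall_nnreal_le fun r => ?_
  obtain ⟨η, hη, H⟩ := h ((r + 1 : ℝ)⁻¹) (by positivity)
  have hm : AEMeasurable g (volume.restrict (Ico 0 1)) :=
    aemeasurable_restrict_of_monotoneOn measurableSet_Ico hg
  set μ : Measure ℝ := (volume.restrict (Ico 0 1)).map g with hμ
  have key : (r + 1) • μ ≤ μH[a] := by
    refine Measure.le_hausdorffMeasure a _ (ENNReal.ofReal η) (by simpa using hη) fun s hs => ?_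
    have hpair : ∀ x ∈ g ⁻¹' closure s ∩ Ico 0 1, ∀ y ∈ g ⁻¹' closure s ∩ Ico 0 1, x < y →
        edist x y ≤ ENNReal.ofReal ((r + 1 : ℝ)⁻¹) * Metric.ediam s ^ a := by
      rintro x ⟨hxs, hx⟩ y ⟨hys, hy⟩ hxy
      have hmon : 0 ≤ g y - g x := sub_nonneg.2 (hg hx hy hxy.le)
      have hd : ENNReal.ofReal (g y - g x) ≤ Metric.ediam s := by
        rw [← Metric.ediam_closure s]
        refine le_of_eq_of_le ?_ (Metric.edist_le_ediam_of_mem hys hxs)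
        rw [edist_dist, Real.dist_eq, abs_of_nonneg hmon]
      have hle : g y - g x ≤ η := (ENNReal.ofReal_le_ofReal_iff hη.le).1 (hd.trans hs)
      have := H x hx y hy hxy hle
      rw [edist_comm, edist_dist, Real.dist_eq, abs_of_pos (sub_pos.2 hxy)]
      refine (ENNReal.ofReal_le_ofReal this).trans ?_
      rw [ENNReal.ofReal_mul (by positivity), ← ENNReal.ofReal_rpow_of_nonneg hmon ha.le]
      gcongr
    have hdiam : Metric.ediam (g ⁻¹' closure s ∩ Ico 0 1) ≤
        ENNReal.ofReal ((r + 1 : ℝ)⁻¹) * Metric.ediam s ^ a := by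
      refine Metric.ediam_le fun x hx y hy => ?_
      rcases lt_trichotomy x y with hxy | rfl | hxy
      · exact hpair x hx y hy hxy
      · simp
      · rw [edist_comm]; exact hpair y hy x hx hxy
    have hs' : μ s ≤ ENNReal.ofReal ((r + 1 : ℝ)⁻¹) * Metric.ediam s ^ a := by
      refine (measure_mono subset_closure).trans ?_
      rw [hμ, Measure.map_apply_of_aemeasurable hm isClosed_closure.measurableSet,
        Measure.restrict_apply' measurableSet_Ico]
      exact (Real.volume_le_diam _).trans hdiam
    calc ((r + 1) • μ) s = ENNReal.ofReal (r + 1 : ℝ) * μ s := by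
          rw [Measure.smul_apply, ENNReal.smul_def, smul_eq_mul]
          congr 1
          rw [ENNReal.ofReal_add (by positivity) (by positivity)]
          simp
      _ ≤ ENNReal.ofReal (r + 1 : ℝ) *
          (ENNReal.ofReal ((r + 1 : ℝ)⁻¹) * Metric.ediam s ^ a) := by gcongr
      _ = Metric.ediam s ^ a := by
          rw [← mul_assoc, ← ENNReal.ofReal_mul (by positivity),
            mul_inv_cancel₀ (by positivity), ENNReal.ofReal_one, one_mul]
  have hone : 1 ≤ μ (g '' Ico 0 1) := by
    refine le_trans ?_ (Measure.le_map_apply_image hm _)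
    simp
  calc (r : ℝ≥0∞) ≤ ((r + 1 : ℝ≥0) : ℝ≥0∞) * 1 := by simp
    _ ≤ ((r + 1) • μ) (g '' Ico 0 1) := by
        rw [Measure.smul_apply, ENNReal.smul_def, smul_eq_mul]; gcongr
    _ ≤ _ := key _

theorem dimH_le_of_forall_near_dyadic {Q : Set ℝ} {a : ℝ} (ha : 0 ≤ a) {L t : ℕ → ℕ} {C : ℕ}
    {l : Filter ℕ} [l.NeBot] (ht : Tendsto t l atTop)
    (hLt : ∀ s > a, Tendsto (fun n => (L n : ℝ) - s * t n) l atBot)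
    (hQ : Q ⊆ Icc 0 (C : ℝ))
    (h : ∀ᶠ n in l, ∀ x ∈ Q, ∃ z : ℤ, |x - z * (1 / 2) ^ L n| ≤ C * (1 / 2) ^ t n) :
    dimH Q ≤ ENNReal.ofReal a := by
  rcases Nat.eq_zero_or_pos C with rfl | hC
  · have : dimH Q ≤ dimH ({0} : Set ℝ) := dimH_mono (by simpa using hQ)
    simpa using this.trans (by simp)
  have hC1 : (1 : ℝ) ≤ C := by exact_mod_cast hC
  refine ENNReal.le_of_forall_pos_le_add fun ε hε _ => ?_
  have hs := hLt (a + ε) (by simpa using hε)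
  set s : ℝ := a + ε with hsdef
  have hs0 : 0 ≤ s := by positivity
  have hz : μH[s] Q ≤ 0 := by
    have hpow : Tendsto (fun n => (1 / 2 : ℝ) ^ t n) l (𝓝 0) :=
      (tendsto_pow_atTop_nhds_zero_of_lt_one (by norm_num) (by norm_num)).comp ht
    have hr : Tendsto (fun n => ENNReal.ofReal (2 * C * (1 / 2 : ℝ) ^ t n)) l (𝓝 0) := by
      have := ENNReal.tendsto_ofReal (hpow.const_mul (2 * C : ℝ))
      simpa using this
    have hd : ∀ (n : ℕ) (z : ℤ), Metric.ediam (Icc ((z : ℝ) * (1 / 2) ^ L n - C * (1 / 2) ^ t n)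
        (z * (1 / 2) ^ L n + C * (1 / 2) ^ t n)) = ENNReal.ofReal (2 * C * (1 / 2 : ℝ) ^ t n) := by
      intro n z
      rw [Real.ediam_Icc]; congr 1; ring
    have main := Measure.hausdorffMeasure_le_liminf_sum s Q _ hr
      (ι := fun n => Finset.Icc (-(C * 2 ^ L n : ℤ)) (2 * C * 2 ^ L n))
      (fun n z => Icc ((z : ℤ) * (1 / 2 : ℝ) ^ L n - C * (1 / 2) ^ t n)
        ((z : ℤ) * (1 / 2) ^ L n + C * (1 / 2) ^ t n))
      (Eventually.of_forall fun n i => (hd n i).le)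
      (h.mono fun n hn x hx => by
        obtain ⟨z, hz⟩ := hn x hx
        obtain ⟨h0, h1⟩ := hQ hx
        obtain ⟨h2, h3⟩ := abs_le.1 hz
        have hp : (0 : ℝ) < 2 ^ L n := by positivity
        have hq : (C : ℝ) * (1 / 2) ^ t n ≤ C :=
          mul_le_of_le_one_right (by positivity) (pow_le_one₀ (by norm_num) (by norm_num))
        have e : (z : ℝ) = z * (1 / 2) ^ L n * 2 ^ L n := by
          rw [mul_assoc, ← mul_pow]; norm_num
        refine mem_iUnion.2 ⟨⟨z, Finset.mem_Icc.2 ⟨?_, ?_⟩⟩, ?_, ?_⟩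
        · have : (-(C * 2 ^ L n) : ℝ) ≤ z := by
            rw [e, ← neg_mul]; gcongr; linarith
          exact_mod_cast this
        · have : (z : ℝ) ≤ 2 * C * 2 ^ L n := by
            rw [e]; exact mul_le_mul_of_nonneg_right (by linarith) hp.le
          exact_mod_cast this
        · simp only; linarith
        · simp only; linarith)
    refine main.trans (le_of_eq ?_)
    have hlim : Tendsto (fun n => ENNReal.ofReal
        (4 * C * (2 * C : ℝ) ^ s * 2 ^ ((L n : ℝ) - s * t n))) l (𝓝 0) := by
      have h1 : Tendsto (fun n => (2 : ℝ) ^ ((L n : ℝ) - s * t n)) l (𝓝 0) :=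
        (tendsto_rpow_atBot_of_base_gt_one 2 (by norm_num)).comp hs
      have := ENNReal.tendsto_ofReal (h1.const_mul (4 * C * (2 * C : ℝ) ^ s))
      simpa using this
    refine (tendsto_of_tendsto_of_tendsto_of_le_of_le tendsto_const_nhds hlim
      (fun _ => zero_le) fun n => ?_).liminf_eq
    simp only [hd, Finset.sum_const, Finset.card_univ, Fintype.card_coe, nsmul_eq_mul]
    rw [ENNReal.ofReal_rpow_of_nonneg (by positivity) hs0, ← ENNReal.ofReal_natCast,
      ← ENNReal.ofReal_mul (by positivity)]
    apply ENNReal.ofReal_le_ofReal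
    have hcard : ((Finset.Icc (-(C * 2 ^ L n : ℤ)) (2 * C * 2 ^ L n)).card : ℝ)
        ≤ 4 * C * 2 ^ L n := by
      have hnat : 1 ≤ C * 2 ^ L n := Nat.mul_pos hC (by positivity)
      have : (Finset.Icc (-(C * 2 ^ L n : ℤ)) (2 * C * 2 ^ L n)).card ≤ 4 * (C * 2 ^ L n) := by
        rw [Int.card_Icc]
        zify at hnat ⊢
        rw [mul_assoc]
        omega
      have h' : ((Finset.Icc (-(C * 2 ^ L n : ℤ)) (2 * C * 2 ^ L n)).card : ℝ)
          ≤ ((4 * (C * 2 ^ L n) : ℕ) : ℝ) := by exact_mod_cast this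
      refine h'.trans (le_of_eq ?_); push_cast; ring
    rw [Real.mul_rpow (by positivity) (by positivity), Real.rpow_sub (by norm_num),
      Real.rpow_natCast]
    have e2 : ((1 / 2 : ℝ) ^ t n) ^ s = (2 ^ (s * (t n : ℝ)))⁻¹ := by
      rw [one_div, inv_pow, Real.inv_rpow (by positivity), ← Real.rpow_natCast,
        ← Real.rpow_mul (by norm_num), mul_comm]
    rw [e2, div_eq_mul_inv]
    calc _ ≤ (4 * C * 2 ^ L n) * ((2 * C : ℝ) ^ s * (2 ^ (s * (t n : ℝ)))⁻¹) := by gcongr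
      _ = _ := by ring
  have hfin : μH[(s.toNNReal : ℝ)] Q ≠ ⊤ := by
    rw [Real.coe_toNNReal s hs0]
    exact (hz.trans_lt (by simp)).ne
  refine (dimH_le_of_hausdorffMeasure_ne_top hfin).trans (le_of_eq ?_)
  rw [← ENNReal.ofReal_coe_nnreal (p := ε), ← ENNReal.ofReal_add ha ε.coe_nonneg]
  rfl

/-- The exponents `L_n` of the dyadic scales `2 ^ (-L_n)` of the construction. -/
def scaleExp (n : ℕ) : ℕ := (n + 1).factorial ^ 2

theorem scaleExp_succ (n : ℕ) : scaleExp (n + 1) = (n + 2) ^ 2 * scaleExp n := by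
  simp only [scaleExp, Nat.factorial_succ (n + 1)]; ring

theorem lt_scaleExp (n : ℕ) : n < scaleExp n := by
  have h := Nat.self_le_factorial (n + 1)
  have h2 : (n + 1).factorial ≤ (n + 1).factorial ^ 2 := Nat.le_self_pow (by norm_num) _
  unfold scaleExp; omega

theorem strictMono_scaleExp : StrictMono scaleExp := by
  refine strictMono_nat_of_lt_succ fun n => ?_
  have := lt_scaleExp n
  rw [scaleExp_succ]
  exact lt_mul_of_one_lt_left (by omega) (by nlinarith)

/-- The exponent of the neighbourhood of `2 ^ (-L_n) ℤ` which is used for dimension `a`. -/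
noncomputable def gapExp (a : ℝ) (n : ℕ) : ℕ :=
  ⌊(scaleExp n : ℝ) * ((n + 1) / (n + 2)) / a⌋₊

theorem gapExp_anti {a b : ℝ} (ha : 0 < a) (hab : a ≤ b) (n : ℕ) : gapExp b n ≤ gapExp a n := by
  unfold gapExp; gcongr

theorem gapExp_le {a : ℝ} (ha : 0 < a) (n : ℕ) :
    a * gapExp a n ≤ scaleExp n * ((n + 1) / (n + 2)) := by
  have := Nat.floor_le (a := (scaleExp n : ℝ) * ((n + 1) / (n + 2)) / a) (by positivity)
  rw [le_div_iff₀ ha] at this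
  unfold gapExp; linarith

theorem lt_gapExp {a : ℝ} (ha : 0 < a) (n : ℕ) :
    scaleExp n * ((n + 1) / (n + 2)) - a < a * gapExp a n := by
  have := Nat.lt_floor_add_one ((scaleExp n : ℝ) * ((n + 1) / (n + 2)) / a)
  rw [div_lt_iff₀ ha] at this
  unfold gapExp; linarith

theorem tendsto_scaleExp : Tendsto (fun n => (scaleExp n : ℝ)) atTop atTop :=
  tendsto_natCast_atTop_atTop.comp strictMono_scaleExp.tendsto_atTop

theorem tendsto_add_one_div_add_two :
    Tendsto (fun n : ℕ => ((n : ℝ) + 1) / (n + 2)) atTop (𝓝 1) := by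
  have h : Tendsto (fun n : ℕ => 1 - 1 / (((n + 1 : ℕ) : ℝ) + 1)) atTop (𝓝 (1 - 0)) :=
    tendsto_const_nhds.sub
      ((tendsto_add_atTop_iff_nat 1).2 (tendsto_one_div_add_atTop_nhds_zero_nat (𝕜 := ℝ)))
  rw [sub_zero] at h
  refine h.congr fun n => ?_
  push_cast
  field_simp
  ring

theorem tendsto_scaleExp_sub_mul_gapExp {a s : ℝ} (ha : 0 < a) (has : a < s) :
    Tendsto (fun n => (scaleExp n : ℝ) - s * gapExp a n) atTop atBot := by
  have h1 : Tendsto (fun n : ℕ => 1 - s / a * (((n : ℝ) + 1) / (n + 2))) atTop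
      (𝓝 (1 - s / a * 1)) :=
    tendsto_const_nhds.sub (tendsto_add_one_div_add_two.const_mul _)
  have hneg : 1 - s / a * 1 < 0 := by
    rw [mul_one, sub_neg, one_lt_div ha]; exact has
  have h2 := tendsto_atBot_add_const_right _ s (tendsto_scaleExp.atTop_mul_neg hneg h1)
  refine tendsto_atBot_mono (fun n => ?_) h2
  have h3 := (mul_lt_mul_iff_right₀ (div_pos (ha.trans has) ha)).2 (lt_gapExp ha n)
  have e : s / a * (a * gapExp a n) = s * gapExp a n := by field_simp
  have e2 : s / a * a = s := by field_simp
  rw [e, mul_sub, e2] at h3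
  linarith

theorem eventually_scaleExp_lt_gapExp {a : ℝ} (ha : 0 < a) (ha1 : a < 1) :
    ∀ᶠ n in atTop, scaleExp n + 1 ≤ gapExp a n := by
  filter_upwards [(tendsto_scaleExp_sub_mul_gapExp ha ha1).eventually_lt_atBot 0] with n hn
  have : (scaleExp n : ℝ) < gapExp a n := by linarith
  exact_mod_cast this

theorem eventually_gapExp_le_scaleExp_succ {a : ℝ} (ha : 0 < a) :
    ∀ᶠ n in atTop, gapExp a n ≤ scaleExp (n + 1) := by
  filter_upwards [tendsto_natCast_atTop_atTop.eventually_ge_atTop (1 / a)] with n hn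
  have h := gapExp_le ha n
  have h1 : ((n : ℝ) + 1) / (n + 2) ≤ 1 := by rw [div_le_one (by positivity)]; linarith
  have h2 : a * gapExp a n ≤ scaleExp n := h.trans (mul_le_of_le_one_right (by positivity) h1)
  have h3 : (1 : ℝ) ≤ a * (n + 2) ^ 2 := by
    rw [div_le_iff₀ ha] at hn
    nlinarith [mul_pos ha ha, (Nat.cast_nonneg n : (0 : ℝ) ≤ n)]
  have : (gapExp a n : ℝ) ≤ ((scaleExp (n + 1) : ℕ) : ℝ) := by
    rw [scaleExp_succ]; push_cast
    refine le_of_mul_le_mul_left ?_ ha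
    nlinarith [(Nat.cast_nonneg (scaleExp n) : (0 : ℝ) ≤ scaleExp n)]
  exact_mod_cast this

theorem tendsto_scaleExp_succ_sub {a : ℝ} (ha : 0 < a) :
    Tendsto (fun n => (scaleExp (n + 1) : ℝ) - gapExp a n - a * gapExp a (n + 1))
      atTop atTop := by
  have h1 : Tendsto (fun n : ℕ => (n : ℝ) + (-1 / a)) atTop atTop :=
    tendsto_atTop_add_const_right _ _ tendsto_natCast_atTop_atTop
  refine tendsto_atTop_mono (fun n => ?_) (tendsto_scaleExp.atTop_mul_atTop₀ h1)
  have h := gapExp_le ha (n + 1)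
  have h0 := gapExp_le ha n
  have h2 : ((n : ℝ) + 1) / (n + 2) ≤ 1 := by rw [div_le_one (by positivity)]; linarith
  have h3 : (gapExp a n : ℝ) ≤ scaleExp n * (1 / a) := by
    rw [mul_one_div, le_div_iff₀ ha, mul_comm]
    exact h0.trans (mul_le_of_le_one_right (by positivity) h2)
  rw [scaleExp_succ] at h ⊢
  push_cast at h ⊢
  have h4 : ((n : ℝ) + 2) ^ 2 * scaleExp n - (n + 2) ^ 2 * scaleExp n * ((n + 1 + 1) / (n + 1 + 2))
      ≥ scaleExp n * n := by
    have e : ((n : ℝ) + 2) ^ 2 * scaleExp n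
      - (n + 2) ^ 2 * scaleExp n * ((n + 1 + 1) / (n + 1 + 2))
      = scaleExp n * ((n + 2) ^ 2 / (n + 3)) := by field_simp; ring
    rw [e]
    have : (n : ℝ) ≤ (n + 2) ^ 2 / (n + 3) := by
      rw [le_div_iff₀ (by positivity)]; nlinarith [(Nat.cast_nonneg n : (0 : ℝ) ≤ n)]
    gcongr
  have e3 : (scaleExp n : ℝ) * (n + -1 / a) = scaleExp n * n - scaleExp n * (1 / a) := by ring
  rw [e3]; linarith

theorem summable_of_le_half_pow {t : ℕ → ℕ} (ht : ∀ n, n ≤ t n) {v : ℕ → ℝ}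
    (h0 : ∀ n, 0 ≤ v n) (hv : ∀ n, v n ≤ (1 / 2) ^ t n) : Summable v :=
  Summable.of_nonneg_of_le h0
    (fun n => (hv n).trans (pow_le_pow_of_le_one (by norm_num) (by norm_num) (ht n)))
    summable_geometric_two

theorem exists_digit_series {a : ℝ} (ha : 0 < a) (ha1 : a < 1) {L t : ℕ → ℕ} (hL : StrictMono L)
    (hLt : ∀ n, L n + 1 ≤ t n) (htL : ∀ n, t n ≤ L (n + 1))
    (hlim : Tendsto (fun n => (L (n + 1) : ℝ) - t n - a * t (n + 1)) atTop atTop) :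
    ∃ u : ℕ → ℝ → ℝ, (∀ n, ∀ x ∈ Ico (0 : ℝ) 1, ∃ z : ℤ, u n x = z * (1 / 2) ^ L (n + 1)) ∧
      (∀ n, ∀ x ∈ Ico (0 : ℝ) 1, 0 ≤ u n x) ∧
      (∀ n, ∀ x ∈ Ico (0 : ℝ) 1, u n x ≤ (1 / 2) ^ t n) ∧
      μH[a] ((fun x => ∑' n, u n x) '' Ico 0 1) = ∞ := by
  set S : ℕ → ℕ := fun n => ∑ i ∈ Finset.range n, (L (i + 1) - t i) with hS
  set F : ℕ → ℝ → ℤ := fun n x => ⌊(2 : ℝ) ^ S n * x⌋ with hF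
  set u : ℕ → ℝ → ℝ := fun n x => F (n + 1) x * (1 / 2) ^ L (n + 1) - F n x * (1 / 2) ^ t n with hu
  have hSs : ∀ n, S (n + 1) = S n + (L (n + 1) - t n) := fun n => Finset.sum_range_succ _ _
  have hpow : ∀ n, (1 / 2 : ℝ) ^ t n = 2 ^ (L (n + 1) - t n) * (1 / 2) ^ L (n + 1) := by
    intro n
    conv_rhs => rw [← Nat.sub_add_cancel (htL n), pow_add, Nat.sub_add_cancel (htL n), ← mul_assoc,
      ← mul_pow]
    norm_num
  have hpos : ∀ n, (0 : ℝ) < (1 / 2) ^ n := fun n => by positivity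
  have hlow : ∀ n x, (2 : ℝ) ^ (L (n + 1) - t n) * F n x ≤ F (n + 1) x := by
    intro n x
    have : ((2 : ℤ) ^ (L (n + 1) - t n) * F n x) ≤ F (n + 1) x := by
      refine Int.le_floor.2 ?_
      push_cast
      rw [hSs, pow_add, mul_comm ((2 : ℝ) ^ S n), mul_assoc]
      gcongr
      exact Int.floor_le _
    exact_mod_cast this
  have hup : ∀ n x, (F (n + 1) x : ℝ) ≤ 2 ^ (L (n + 1) - t n) * F n x + 2 ^ (L (n + 1) - t n) := by
    intro n x
    refine (Int.floor_le _).trans ?_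
    rw [hSs, pow_add, mul_comm ((2 : ℝ) ^ S n), mul_assoc, ← mul_add_one]
    gcongr
    exact (Int.lt_floor_add_one _).le
  have hu0 : ∀ n x, 0 ≤ u n x := by
    intro n x
    have := mul_le_mul_of_nonneg_right (hlow n x) (hpos (L (n + 1))).le
    simp only [hu, hpow n]
    linarith
  have hu1 : ∀ n x, u n x ≤ (1 / 2) ^ t n := by
    intro n x
    have := mul_le_mul_of_nonneg_right (hup n x) (hpos (L (n + 1))).le
    simp only [hu, hpow n]
    linarith
  have htn : ∀ n, n ≤ t n := fun n => (hL.le_apply).trans (by have := hLt n; omega)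
  have hsum : ∀ x, Summable (fun n => u n x) := fun x =>
    summable_of_le_half_pow htn (fun n => hu0 n x) fun n => hu1 n x
  refine ⟨u, fun n x _ => ⟨F (n + 1) x - 2 ^ (L (n + 1) - t n) * F n x, ?_⟩, fun n x _ => hu0 n x,
    fun n x _ => hu1 n x, ?_⟩
  · simp only [hu, hpow n]; push_cast; ring
  have hFmono : ∀ n x y, x ≤ y → F n x ≤ F n y := fun n x y hxy => by
    simp only [hF]; gcongr
  have hF0 : ∀ x ∈ Ico (0 : ℝ) 1, F 0 x = 0 := by
    intro x hx
    simp only [hF, hS, Finset.range_zero, Finset.sum_empty, pow_zero, one_mul]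
    exact Int.floor_eq_zero_iff.2 hx
  have habel : ∀ x ∈ Ico (0 : ℝ) 1, ∀ n, ∑ i ∈ Finset.range n, u i x = F n x * (1 / 2) ^ L n +
      ∑ i ∈ Finset.range n, F i x * ((1 / 2 : ℝ) ^ L i - (1 / 2) ^ t i) := by
    intro x hx n
    induction n with
    | zero => simp [hF0 x hx]
    | succ n ih => rw [Finset.sum_range_succ, ih, Finset.sum_range_succ]; simp only [hu]; ring
  have hhalf : ∀ n, (1 / 2 : ℝ) ^ t n ≤ (1 / 2) ^ L n * (1 / 2) := by
    intro n
    rw [← pow_succ]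
    exact pow_le_pow_of_le_one (by norm_num) (by norm_num) (hLt n)
  have hgap : ∀ x ∈ Ico (0 : ℝ) 1, ∀ y ∈ Ico (0 : ℝ) 1, x ≤ y → ∀ n,
      ((F n y : ℝ) - F n x) * ((1 / 2) ^ L n * (1 / 2)) ≤ ∑' n, u n y - ∑' n, u n x := by
    intro x hx y hy hxy n
    refine ge_of_tendsto ((hsum y).hasSum.tendsto_sum_nat.sub (hsum x).hasSum.tendsto_sum_nat) ?_
    filter_upwards [eventually_gt_atTop n] with N hN
    have hΔ : ∀ i, (0 : ℝ) ≤ (F i y : ℝ) - F i x := fun i => by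
      have := hFmono i x y hxy
      rw [sub_nonneg]; exact_mod_cast this
    have hc : ∀ i, (0 : ℝ) ≤ (1 / 2 : ℝ) ^ L i - (1 / 2) ^ t i := fun i => by
      have := hhalf i; have := hpos (L i); linarith
    have e : ∑ i ∈ Finset.range N, u i y - ∑ i ∈ Finset.range N, u i x =
        ((F N y : ℝ) - F N x) * (1 / 2) ^ L N + ∑ i ∈ Finset.range N,
          ((F i y : ℝ) - F i x) * ((1 / 2 : ℝ) ^ L i - (1 / 2) ^ t i) := by
      rw [habel y hy, habel x hx]
      simp only [sub_mul, Finset.sum_sub_distrib]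
      ring
    rw [e]
    have h1 := Finset.single_le_sum (f := fun i => ((F i y : ℝ) - F i x) *
      ((1 / 2 : ℝ) ^ L i - (1 / 2) ^ t i)) (fun i _ => mul_nonneg (hΔ i) (hc i))
      (Finset.mem_range.2 hN)
    have h2 : ((F n y : ℝ) - F n x) * ((1 / 2) ^ L n * (1 / 2)) ≤
        ((F n y : ℝ) - F n x) * ((1 / 2 : ℝ) ^ L n - (1 / 2) ^ t n) := by
      refine mul_le_mul_of_nonneg_left ?_ (hΔ n)
      have := hhalf n; linarith
    have h3 := mul_nonneg (hΔ N) (hpos (L N)).le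
    linarith
  have hmono : MonotoneOn (fun x => ∑' n, u n x) (Ico 0 1) := by
    intro x hx y hy hxy
    have := hgap x hx y hy hxy 0
    rw [hF0 x hx, hF0 y hy, sub_self, zero_mul] at this
    exact sub_nonneg.1 this
  have hSlim : Tendsto (fun n => (S (n + 1) : ℝ) - a * t (n + 1)) atTop atTop := by
    refine tendsto_atTop_mono (fun n => ?_) hlim
    have : L (n + 1) ≤ S (n + 1) + t n := by rw [hSs]; have := htL n; omega
    have : (L (n + 1) : ℝ) ≤ S (n + 1) + t n := by exact_mod_cast this
    linarith
  refine hausdorffMeasure_image_Ico_eq_top ha hmono fun ε hε => ?_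
  have hεlim : Tendsto (fun n => 4 * (2 : ℝ) ^ (-((S (n + 1) : ℝ) - a * t (n + 1)))) atTop
      (𝓝 0) := by
    have := ((tendsto_rpow_atBot_of_base_gt_one 2 (by norm_num)).comp
      (tendsto_neg_atTop_atBot.comp hSlim)).const_mul 4
    simpa using this
  obtain ⟨K, hK⟩ := eventually_atTop.1 (hεlim.eventually_le_const hε)
  refine ⟨(1 / 2) ^ L (K + 2) * (1 / 2) * (1 / 2), by positivity, fun x hx y hy hxy hle => ?_⟩
  have hex : ∃ n, F n x < F n y := by
    have h1 : Tendsto (fun n => (2 : ℝ) ^ (S (n + 1))) atTop atTop := by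
      have : Tendsto (fun n => (S (n + 1) : ℝ)) atTop atTop :=
        tendsto_atTop_mono (fun n => by
          have : 0 ≤ a * (t (n + 1) : ℝ) := by positivity
          linarith) hSlim
      exact (tendsto_pow_atTop_atTop_of_one_lt (by norm_num)).comp
        (tendsto_natCast_atTop_iff.1 this)
    obtain ⟨n, hn⟩ := (h1.eventually_ge_atTop (1 / (y - x))).exists
    refine ⟨n + 1, ?_⟩
    rw [div_le_iff₀ (sub_pos.2 hxy)] at hn
    rw [← Int.add_one_le_iff]
    refine Int.le_floor.2 ?_
    push_cast
    have := Int.floor_le ((2 : ℝ) ^ S (n + 1) * x)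
    simp only [hF]
    linarith
  classical
  obtain ⟨n, hn⟩ : ∃ n, Nat.find hex = n + 1 := Nat.exists_eq_succ_of_ne_zero fun h0 => by
    have := Nat.find_spec hex
    rw [h0, hF0 x hx, hF0 y hy] at this
    exact lt_irrefl _ this
  have hlt : F (n + 1) x + 1 ≤ F (n + 1) y := by
    have := Nat.find_spec hex
    rw [hn] at this
    omega
  have heq : F n y ≤ F n x := not_lt.1 (Nat.find_min hex (by omega))
  set δ := ∑' n, u n y - ∑' n, u n x with hδ
  have hδ1 := hgap x hx y hy hxy.le (n + 1)
  rw [← hδ] at hδ1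
  have hltR : (F (n + 1) x : ℝ) + 1 ≤ F (n + 1) y := by exact_mod_cast hlt
  have heqR : (F n y : ℝ) ≤ F n x := by exact_mod_cast heq
  have hδ2 : (1 / 2 : ℝ) ^ L (n + 1) * (1 / 2) ≤ δ := by
    refine le_trans ?_ hδ1
    refine le_mul_of_one_le_left (by positivity) (by linarith)
  have hKn : K + 1 ≤ n := by
    by_contra! hlt'
    have h1 : L (n + 1) ≤ L (K + 2) := hL.monotone (by omega)
    have h2 : (1 / 2 : ℝ) ^ L (K + 2) ≤ (1 / 2) ^ L (n + 1) :=
      pow_le_pow_of_le_one (by norm_num) (by norm_num) h1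
    have h3 := hpos (L (K + 2))
    have : δ ≤ (1 / 2) ^ L (K + 2) * (1 / 2) * (1 / 2) := hle
    linarith
  have hS1 : (2 : ℝ) ^ S n * (y - x) ≤ 1 := by
    have h1 := Int.floor_le ((2 : ℝ) ^ S n * x)
    have h2 := Int.lt_floor_add_one ((2 : ℝ) ^ S n * y)
    simp only [hF] at heqR
    linarith
  have hS2 : (2 : ℝ) ^ S n * (y - x) ≤ 4 * 2 ^ t n * δ := by
    have h1 := Int.floor_le ((2 : ℝ) ^ S (n + 1) * x)
    have h2 := Int.lt_floor_add_one ((2 : ℝ) ^ S (n + 1) * y)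
    simp only [hF] at hltR hδ1
    have h3 : (2 : ℝ) ^ S (n + 1) * (y - x) * ((1 / 2) ^ L (n + 1) * (1 / 2)) ≤ 2 * δ := by
      refine le_trans ?_ (mul_le_mul_of_nonneg_left hδ1 zero_le_two)
      refine (mul_le_mul_of_nonneg_right (b := (2 : ℝ) ^ S (n + 1) * (y - x)) (c :=
        2 * ((⌊(2 : ℝ) ^ S (n + 1) * y⌋ : ℝ) - ⌊(2 : ℝ) ^ S (n + 1) * x⌋)) ?_
        (by positivity)).trans_eq (mul_assoc _ _ _)
      linarith
    have h4 : (2 : ℝ) ^ t n * (1 / 2) ^ t n = 1 := by rw [← mul_pow]; norm_num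
    rw [hSs, pow_add] at h3
    calc (2 : ℝ) ^ S n * (y - x) = 2 * 2 ^ t n * (2 ^ S n * 2 ^ (L (n + 1) - t n) * (y - x) *
          ((1 / 2) ^ L (n + 1) * (1 / 2))) := by
          linear_combination (-(2 : ℝ) ^ S n * (y - x)) * h4 +
            (2 : ℝ) ^ S n * (y - x) * 2 ^ t n * hpow n
      _ ≤ 2 * 2 ^ t n * (2 * δ) := by gcongr
      _ = _ := by ring
  have hδ0 : 0 < δ := lt_of_lt_of_le (by positivity) hδ2
  have hw0 : 0 < (2 : ℝ) ^ S n * (y - x) := mul_pos (by positivity) (sub_pos.2 hxy)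
  have hw : (2 : ℝ) ^ S n * (y - x) ≤ 4 * 2 ^ (a * t n) * δ ^ a := by
    calc (2 : ℝ) ^ S n * (y - x) ≤ (2 ^ S n * (y - x)) ^ a := by
          simpa using Real.rpow_le_rpow_of_exponent_ge hw0 hS1 ha1.le
      _ ≤ (4 * 2 ^ t n * δ) ^ a := Real.rpow_le_rpow hw0.le hS2 ha.le
      _ = 4 ^ a * 2 ^ (a * t n) * δ ^ a := by
          rw [Real.mul_rpow (by positivity) hδ0.le, Real.mul_rpow (by norm_num) (by positivity),
            ← Real.rpow_natCast 2 (t n), ← Real.rpow_mul (by norm_num), mul_comm a]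
      _ ≤ 4 * 2 ^ (a * t n) * δ ^ a := by
          gcongr
          simpa using Real.rpow_le_rpow_of_exponent_le (x := 4) (by norm_num) ha1.le
  obtain ⟨m, rfl⟩ : ∃ m, n = m + 1 := ⟨n - 1, by omega⟩
  have hKm := hK m (by omega)
  calc y - x = ((2 : ℝ) ^ S (m + 1))⁻¹ * (2 ^ S (m + 1) * (y - x)) := by field_simp
    _ ≤ ((2 : ℝ) ^ S (m + 1))⁻¹ * (4 * 2 ^ (a * t (m + 1)) * δ ^ a) := by gcongr
    _ = 4 * (2 : ℝ) ^ (-((S (m + 1) : ℝ) - a * t (m + 1))) * δ ^ a := by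
        rw [neg_sub, Real.rpow_sub (by norm_num), Real.rpow_natCast]
        field_simp
    _ ≤ ε * δ ^ a := by gcongr

/-- There is a choice of an active index `act n k ≤ k` for all `n` and `k` such that any `j` pairs
`(k, m)` satisfy, for infinitely many `n`, that `m` is active in `k` only if `k < j`. -/
theorem exists_active_index : ∃ act : ℕ → (k : ℕ) → Fin (k + 1),
    ∀ (j : ℕ) (p : Fin j → Σ k : ℕ, Fin (k + 1)),
      ∃ᶠ n in atTop, ∀ i, act n (p i).1 = (p i).2 → (p i).1 + 1 ≤ j := by
  classical
  obtain ⟨f, hf⟩ := exists_surjective_nat (Finset (Σ k : ℕ, Fin (k + 1)))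
  refine ⟨fun n k => if h : ∃ m : Fin (k + 1), (⟨k, m⟩ : Σ k : ℕ, Fin (k + 1)) ∉ f n.unpair.1
    then h.choose else 0, fun j p => ?_⟩
  obtain ⟨c, hc⟩ := hf (Finset.univ.image p)
  refine frequently_atTop.2 fun N => ⟨Nat.pair c N, Nat.right_le_pair c N, fun i hi => ?_⟩
  simp only [Nat.unpair_pair, hc] at hi
  split_ifs at hi with h
  · have := h.choose_spec
    rw [hi] at this
    exact absurd (Finset.mem_image_of_mem p (Finset.mem_univ i)) this
  · push Not at h
    have hsub : Finset.univ.map (Function.Embedding.sigmaMk (p i).1) ⊆ Finset.univ.image p := by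
      intro x hx
      obtain ⟨m, -, rfl⟩ := Finset.mem_map.1 hx
      exact h m
    simpa using (Finset.card_le_card hsub).trans Finset.card_image_le

theorem isClosed_setOf_near_int_mul {c : ℝ} (hc : 0 < c) (r : ℝ) :
    IsClosed {x : ℝ | ∃ z : ℤ, |x - z * c| ≤ r} := by
  have : {x : ℝ | ∃ z : ℤ, |x - z * c| ≤ r} = {x | ‖((x / c : ℝ) : UnitAddCircle)‖ ≤ r / c} := by
    have key : ∀ (x : ℝ) (z : ℤ), |x / c - z| = |x - z * c| / c := fun x z => by
      rw [← abs_of_pos hc, ← abs_div, abs_of_pos hc, sub_div, mul_div_cancel_right₀ _ hc.ne']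
    ext x
    simp only [mem_ofPred_eq, UnitAddCircle.norm_eq]
    constructor
    · rintro ⟨z, hz⟩
      refine (round_le _ z).trans ?_
      rw [key]
      gcongr
    · intro h
      refine ⟨round (x / c), ?_⟩
      rwa [key, div_le_div_iff_of_pos_right hc] at h
  rw [this]
  exact isClosed_le (continuous_norm.comp ((AddCircle.continuous_mk' 1).comp
    (continuous_id.div_const c))) continuous_const

open Classical in
/-- The points of `[0, 2 ^ (-L_N)]` which for every `n ≥ N` are `2 ^ (-L_{n+1})`-close to
`2 ^ (-L_n) ℤ`, where an additional error `2 ^ (-t_n)` is allowed if `on n` holds. -/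
def nearDyadicSet (L t : ℕ → ℕ) (on : ℕ → Prop) (N : ℕ) : Set ℝ :=
  Icc 0 ((1 / 2) ^ L N) ∩ {x | ∀ n ≥ N, ∃ z : ℤ, |x - z * (1 / 2) ^ L n| ≤
    (if on n then (1 / 2) ^ t n else 0) + (1 / 2) ^ L (n + 1)}

theorem isClosed_nearDyadicSet (L t : ℕ → ℕ) (on : ℕ → Prop) (N : ℕ) :
    IsClosed (nearDyadicSet L t on N) := by
  refine isClosed_Icc.inter ?_
  simp only [ofPred_forall]
  exact isClosed_iInter fun n => isClosed_iInter fun _ =>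
    isClosed_setOf_near_int_mul (by positivity) _

theorem zero_mem_nearDyadicSet (L t : ℕ → ℕ) (on : ℕ → Prop) (N : ℕ) :
    (0 : ℝ) ∈ nearDyadicSet L t on N := by
  refine ⟨⟨le_rfl, by positivity⟩, fun n _ => ⟨0, ?_⟩⟩
  simp only [Int.cast_zero, zero_mul, sub_zero, abs_zero]
  split_ifs <;> positivity

open Classical in
theorem tsum_mem_nearDyadicSet {L t : ℕ → ℕ} {on : ℕ → Prop} {N : ℕ} (hL : StrictMono L)
    (hLt : ∀ n ≥ N, L n + 1 ≤ t n) {v : ℕ → ℝ}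
    (hz : ∀ n, ∃ z : ℤ, v n = z * (1 / 2) ^ L (N + n + 1)) (h0 : ∀ n, 0 ≤ v n)
    (hv : ∀ n, v n ≤ if on (N + n) then (1 / 2) ^ t (N + n) else 0) :
    ∑' n, v n ∈ nearDyadicSet L t on N := by
  have hv' : ∀ n, v n ≤ (1 / 2) ^ t (N + n) := fun n => by
    refine (hv n).trans ?_
    split_ifs
    · rfl
    · positivity
  have hsum : Summable v := summable_of_le_half_pow (fun n => by
    have h1 := hLt (N + n) (by omega)
    have h2 := hL.le_apply (x := N + n)
    omega) h0 hv'
  have htail : ∀ n, ∑' i, v (i + n) ≤ (1 / 2) ^ L (N + n) := by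
    intro n
    rw [← tsum_geometric_two' ((1 / 2 : ℝ) ^ L (N + n))]
    refine ((summable_nat_add_iff n).2 hsum).tsum_le_tsum (fun i => (hv' _).trans ?_)
      (summable_geometric_two' _)
    have h1 := hLt (N + (i + n)) (by omega)
    have h2 := hL.add_le_nat i (N + n)
    have h3 : i + (N + n) = N + (i + n) := by omega
    rw [h3] at h2
    calc (1 / 2 : ℝ) ^ t (N + (i + n)) ≤ (1 / 2) ^ (L (N + n) + 1 + i) :=
          pow_le_pow_of_le_one (by norm_num) (by norm_num) (by omega)
      _ = _ := by rw [pow_add, pow_succ, one_div_pow 2 i]; ring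
  have hpart : ∀ m, ∃ z : ℤ, ∑ i ∈ Finset.range m, v i = z * (1 / 2) ^ L (N + m) := by
    intro m
    induction m with
    | zero => exact ⟨0, by simp⟩
    | succ m ih =>
      obtain ⟨z, hz1⟩ := ih
      obtain ⟨w, hw⟩ := hz m
      refine ⟨z * 2 ^ (L (N + m + 1) - L (N + m)) + w, ?_⟩
      have hle : L (N + m) ≤ L (N + m + 1) := hL.monotone (by omega)
      rw [Finset.sum_range_succ, hz1, hw, ← add_assoc]
      push_cast
      rw [add_mul, mul_assoc]
      congr 2
      conv_rhs => rw [← Nat.sub_add_cancel hle, pow_add, Nat.sub_add_cancel hle, ← mul_assoc,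
        ← mul_pow]
      norm_num
  refine ⟨⟨tsum_nonneg h0, by simpa using htail 0⟩, fun n hn => ?_⟩
  obtain ⟨m, rfl⟩ := Nat.exists_eq_add_of_le hn
  obtain ⟨z, hz⟩ := hpart m
  refine ⟨z, ?_⟩
  have h1 := hsum.sum_add_tsum_nat_add (m + 1)
  rw [Finset.sum_range_succ, hz] at h1
  have h2 := htail (m + 1)
  have h3 := hv m
  have h4 : 0 ≤ ∑' i, v (i + (m + 1)) := tsum_nonneg fun i => h0 _
  rw [← h1, abs_le, add_assoc N m 1]
  have := h0 m
  constructor <;> linarith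

theorem isClosed_iUnion_of_subset_Icc {ι : Type*} [Nonempty ι] {P : ι → Set ℝ} {ε : ι → ℝ}
    (hP : ∀ i, IsClosed (P i)) (h0 : ∀ i, 0 ∈ P i) (hsub : ∀ i, P i ⊆ Icc 0 (ε i))
    (hε : Tendsto ε cofinite (𝓝 0)) : IsClosed (⋃ i, P i) := by
  refine isClosed_of_closure_subset fun x hx => ?_
  have hx0 : 0 ≤ x := closure_minimal (iUnion_subset fun i => (hsub i).trans Icc_subset_Ici_self)
    isClosed_Ici hx
  rcases hx0.eq_or_lt with rfl | hpos
  · exact mem_iUnion.2 ⟨Classical.arbitrary ι, h0 _⟩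
  have hfin : {i | ¬ ε i < x / 2}.Finite := hε.eventually_lt_const (half_pos hpos)
  have hcl : IsClosed (Icc 0 (x / 2) ∪ ⋃ i ∈ {i | ¬ ε i < x / 2}, P i) :=
    isClosed_Icc.union (hfin.isClosed_biUnion fun i _ => hP i)
  have hmem := closure_minimal (iUnion_subset fun i y hy => ?_) hcl hx
  · rcases hmem with h | h
    · linarith [h.2]
    · obtain ⟨i, -, hi⟩ := mem_iUnion₂.1 h
      exact mem_iUnion.2 ⟨i, hi⟩
  · by_cases hi : ε i < x / 2
    · exact Or.inl ⟨(hsub i hy).1, (hsub i hy).2.trans hi.le⟩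
    · exact Or.inr (mem_iUnion₂.2 ⟨i, hi, hy⟩)

section Pieces

variable (b : ℕ → ℝ) (N : ℕ → ℕ) (act : ℕ → (k : ℕ) → Fin (k + 1))

/-- The `m`-th of the `k + 1` pieces whose sum has dimension `b k`. -/
def sumsetPiece (i : Σ k : ℕ, Fin (k + 1)) : Set ℝ :=
  nearDyadicSet scaleExp (gapExp (b i.1)) (fun n => act n i.1 = i.2) (N i.1)

theorem sumsetPiece_subset_Icc {i : Σ k : ℕ, Fin (k + 1)} (hN : i.1 + 1 ≤ N i.1) :
    sumsetPiece b N act i ⊆ Icc 0 ((1 / 2) ^ (i.1 + 1)) := by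
  refine inter_subset_left.trans (Icc_subset_Icc_right ?_)
  exact pow_le_pow_of_le_one (by norm_num) (by norm_num) (hN.trans (lt_scaleExp _).le)

theorem isClosed_iUnion_sumsetPiece (hN : ∀ k, k + 1 ≤ N k) :
    IsClosed (⋃ i, sumsetPiece b N act i) := by
  refine isClosed_iUnion_of_subset_Icc (fun i => isClosed_nearDyadicSet _ _ _ _)
    (fun i => zero_mem_nearDyadicSet _ _ _ _) (fun i => sumsetPiece_subset_Icc b N act (hN _)) ?_
  have h1 : Tendsto (fun k : ℕ => (1 / 2 : ℝ) ^ (k + 1)) cofinite (𝓝 0) := by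
    rw [Nat.cofinite_eq_atTop]
    exact (tendsto_add_atTop_iff_nat 1).2
      (tendsto_pow_atTop_nhds_zero_of_lt_one (by norm_num) (by norm_num))
  refine h1.comp (Tendsto.cofinite_of_finite_preimage_singleton fun k => ?_)
  refine (Set.finite_range fun m : Fin (k + 1) => (⟨k, m⟩ : Σ k : ℕ, Fin (k + 1))).subset ?_
  rintro ⟨k', m⟩ rfl
  exact mem_range_self m

variable {b N act}

theorem dimH_sumSet_iUnion_sumsetPiece_le (hb : Monotone b) (hb0 : ∀ k, 0 < b k)
    (hb1 : ∀ k, b k < 1) (hN : ∀ k, k + 1 ≤ N k)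
    (hact : ∀ (j : ℕ) (p : Fin j → Σ k : ℕ, Fin (k + 1)),
      ∃ᶠ n in atTop, ∀ i, act n (p i).1 = (p i).2 → (p i).1 + 1 ≤ j) (k : ℕ) :
    dimH (sumSet (⋃ i, sumsetPiece b N act i) (k + 1)) ≤ ENNReal.ofReal (b k) := by
  have hcover : sumSet (⋃ i, sumsetPiece b N act i) (k + 1) ⊆
      ⋃ p : Fin (k + 1) → Σ k : ℕ, Fin (k + 1),
        {x | ∃ f : Fin (k + 1) → ℝ, (∀ i, f i ∈ sumsetPiece b N act (p i)) ∧ ∑ i, f i = x} := by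
    rintro x ⟨f, hf, rfl⟩
    choose p hp using fun i => mem_iUnion.1 (hf i)
    exact mem_iUnion.2 ⟨p, f, hp, rfl⟩
  refine (dimH_mono hcover).trans ?_
  rw [dimH_iUnion]
  refine iSup_le fun p => ?_
  set l : Filter ℕ := atTop ⊓ 𝓟 {n | ∀ i, act n (p i).1 = (p i).2 → (p i).1 + 1 ≤ k + 1} with hl
  have : l.NeBot := frequently_mem_iff_neBot.1 (hact (k + 1) p)
  have hgap : Tendsto (gapExp (b k)) atTop atTop :=
    tendsto_atTop_mono' _ ((eventually_scaleExp_lt_gapExp (hb0 k) (hb1 k)).mono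
      fun n hn => (Nat.le_succ _).trans hn) strictMono_scaleExp.tendsto_atTop
  refine dimH_le_of_forall_near_dyadic (hb0 k).le (C := 2 * (k + 1)) (l := l)
    (hgap.mono_left inf_le_left)
    (fun s hs => (tendsto_scaleExp_sub_mul_gapExp (hb0 k) hs).mono_left inf_le_left) ?_ ?_
  · rintro x ⟨f, hf, rfl⟩
    have hf1 : ∀ i, 0 ≤ f i ∧ f i ≤ 1 := fun i => by
      have := sumsetPiece_subset_Icc b N act (hN _) (hf i)
      exact ⟨this.1, this.2.trans (pow_le_one₀ (by norm_num) (by norm_num))⟩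
    refine ⟨Finset.sum_nonneg fun i _ => (hf1 i).1, ?_⟩
    refine (Finset.sum_le_card_nsmul _ _ 1 fun i _ => (hf1 i).2).trans ?_
    simp only [Finset.card_univ, Fintype.card_fin, nsmul_eq_mul, mul_one]
    push_cast
    linarith [(Nat.cast_nonneg k : (0 : ℝ) ≤ k)]
  · filter_upwards [mem_inf_of_right (mem_principal_self _),
      mem_inf_of_left (eventually_gapExp_le_scaleExp_succ (hb0 k)),
      mem_inf_of_left (eventually_all.2 fun i => eventually_ge_atTop (N (p i).1))]
      with n hn hle hNn
    rintro x ⟨f, hf, rfl⟩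
    choose z hz using fun i => (hf i).2 n (hNn i)
    refine ⟨∑ i, z i, ?_⟩
    push_cast
    rw [Finset.sum_mul, ← Finset.sum_sub_distrib]
    refine (Finset.abs_sum_le_sum_abs _ _).trans ?_
    have hterm : ∀ i, |f i - z i * (1 / 2) ^ scaleExp n| ≤ 2 * (1 / 2) ^ gapExp (b k) n := by
      intro i
      refine (hz i).trans ?_
      have h1 : (1 / 2 : ℝ) ^ scaleExp (n + 1) ≤ (1 / 2) ^ gapExp (b k) n :=
        pow_le_pow_of_le_one (by norm_num) (by norm_num) hle
      have h2 : (0 : ℝ) ≤ (1 / 2) ^ gapExp (b k) n := by positivity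
      split_ifs with hon
      · have hk : (p i).1 ≤ k := by have := hn i hon; omega
        have h3 : (1 / 2 : ℝ) ^ gapExp (b (p i).1) n ≤ (1 / 2) ^ gapExp (b k) n :=
          pow_le_pow_of_le_one (by norm_num) (by norm_num) (gapExp_anti (hb0 _) (hb hk) n)
        linarith
      · linarith
    refine (Finset.sum_le_card_nsmul _ _ _ fun i _ => hterm i).trans (le_of_eq ?_)
    simp only [Finset.card_univ, Fintype.card_fin, nsmul_eq_mul]
    push_cast
    ring

theorem hausdorffMeasure_sumSet_iUnion_sumsetPiece (hb0 : ∀ k, 0 < b k) (hb1 : ∀ k, b k < 1)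
    (hN : ∀ k, ∀ n ≥ N k, scaleExp n + 1 ≤ gapExp (b k) n ∧ gapExp (b k) n ≤ scaleExp (n + 1))
    (k : ℕ) : μH[b k] (sumSet (⋃ i, sumsetPiece b N act i) (k + 1)) = ∞ := by
  obtain ⟨u, hz, h0, hu, htop⟩ := exists_digit_series (hb0 k) (hb1 k)
    (L := fun n => scaleExp (N k + n)) (t := fun n => gapExp (b k) (N k + n))
    (strictMono_scaleExp.comp fun _ _ h => Nat.add_lt_add_left h _)
    (fun n => (hN k _ (by omega)).1) (fun n => (hN k _ (by omega)).2)
    ((tendsto_scaleExp_succ_sub (hb0 k)).comp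
      (tendsto_atTop_mono (fun n => Nat.le_add_left n (N k)) tendsto_id))
  refine measure_mono_top ?_ htop
  rintro _ ⟨x, hx, rfl⟩
  classical
  have hmem : ∀ m : Fin (k + 1), (∑' n, if act (N k + n) k = m then u n x else 0) ∈
      sumsetPiece b N act ⟨k, m⟩ := by
    intro m
    refine tsum_mem_nearDyadicSet strictMono_scaleExp (fun n hn => (hN k n hn).1)
      (fun n => ?_) (fun n => ?_) (fun n => ?_)
    · split_ifs
      · exact hz n x hx
      · exact ⟨0, by simp⟩
    · split_ifs
      · exact h0 n x hx
      · rfl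
    · simp only
      split_ifs
      · exact hu n x hx
      · rfl
  refine ⟨fun m => ∑' n, if act (N k + n) k = m then u n x else 0,
    fun m => mem_iUnion.2 ⟨_, hmem m⟩, ?_⟩
  have hsum : Summable (fun n => u n x) := summable_of_le_half_pow (fun n => by
    have h1 := (hN k (N k + n) (by omega)).1
    have h2 := strictMono_scaleExp.le_apply (x := N k + n)
    omega) (fun n => h0 n x hx) fun n => hu n x hx
  rw [← Summable.tsum_finsetSum fun m _ => hsum.of_nonneg_of_le (fun n => ?_) fun n => ?_]
  · simp
  · split_ifs
    · exact h0 n x hx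
    · rfl
  · split_ifs
    · rfl
    · exact h0 n x hx

end Pieces

theorem exists_compact_set_prescribed_sumset_dimensions
    (α : ℕ → ℝ) (hmem : ∀ j, 1 ≤ j → α j ∈ Ioo (0 : ℝ) 1)
    (hmono : ∀ j, 1 ≤ j → α j ≤ α (j + 1)) :
    ∃ A : Set ℝ, IsCompact A ∧ A ⊆ Ico (0 : ℝ) 1 ∧
      (∀ j, 1 ≤ j → dimH (sumSet A j) = ENNReal.ofReal (α j)) ∧
      μH[α 1] A = ∞ := by
  set b : ℕ → ℝ := fun k => α (k + 1) with hbdef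
  have hb : Monotone b := monotone_nat_of_le_succ fun k => hmono (k + 1) (by omega)
  have hb0 : ∀ k, 0 < b k := fun k => (hmem (k + 1) (by omega)).1
  have hb1 : ∀ k, b k < 1 := fun k => (hmem (k + 1) (by omega)).2
  have hex : ∀ k, ∃ N, k + 1 ≤ N ∧ ∀ n ≥ N,
      scaleExp n + 1 ≤ gapExp (b k) n ∧ gapExp (b k) n ≤ scaleExp (n + 1) := by
    intro k
    obtain ⟨N, hN⟩ := eventually_atTop.1 ((eventually_scaleExp_lt_gapExp (hb0 k) (hb1 k)).and
      (eventually_gapExp_le_scaleExp_succ (hb0 k)))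
    exact ⟨max (k + 1) N, le_max_left _ _, fun n hn => hN n ((le_max_right _ _).trans hn)⟩
  choose N hkN hN using hex
  obtain ⟨act, hact⟩ := exists_active_index
  have hsub : ⋃ i, sumsetPiece b N act i ⊆ Icc 0 (1 / 2) := by
    refine iUnion_subset fun i => (sumsetPiece_subset_Icc b N act (hkN _)).trans
      (Icc_subset_Icc_right ?_)
    simpa using pow_le_pow_of_le_one (a := (1 / 2 : ℝ)) (by norm_num) (by norm_num)
      (Nat.succ_le_succ (Nat.zero_le i.1))
  have htop := hausdorffMeasure_sumSet_iUnion_sumsetPiece (act := act) hb0 hb1 hN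
  refine ⟨⋃ i, sumsetPiece b N act i, isCompact_Icc.of_isClosed_subset
    (isClosed_iUnion_sumsetPiece b N act hkN) hsub,
    hsub.trans (Icc_subset_Ico_right (by norm_num)), fun j hj => ?_, ?_⟩
  · obtain ⟨k, rfl⟩ := Nat.exists_eq_add_of_le' hj
    refine le_antisymm (dimH_sumSet_iUnion_sumsetPiece_le hb hb0 hb1 hkN hact k) ?_
    refine le_dimH_of_hausdorffMeasure_eq_top ?_
    rw [Real.coe_toNNReal _ (hb0 k).le]
    exact htop k
  · refine measure_mono_top ?_ (htop 0)
    rintro x ⟨f, hf, rfl⟩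
    simpa using hf 0
end

section
/- Let S be a set of positive integers and let A = { ∑_{j ∈ T} 2^{−j} : T ⊆ S } ⊆ [0,1), i.e. the set of x ∈ [0,1) whose binary digits vanish outside S. Then dim_H(A) = den(S), where den(S) = liminf_{n→∞} |S ∩ {1, 2, ..., n}| / n is the lower asymptotic density of S. -/
open MeasureTheory Set Filter
open scoped ENNReal

open Classical in
/-- The elements of `T` between `1` and `n`, as a finset. -/
noncomputable def initialPart (T : Set ℕ) (n : ℕ) : Finset ℕ :=
  {j ∈ Finset.Icc 1 n | j ∈ T}

theorem mem_initialPart {T : Set ℕ} {n j : ℕ} :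
    j ∈ initialPart T n ↔ (1 ≤ j ∧ j ≤ n) ∧ j ∈ T := by
  simp [initialPart]

theorem initialPart_subset_Icc (T : Set ℕ) (n : ℕ) : initialPart T n ⊆ Finset.Icc 1 n :=
  fun _ hj => Finset.mem_Icc.2 (mem_initialPart.1 hj).1

theorem initialPart_mono {T S : Set ℕ} (h : T ⊆ S) (n : ℕ) :
    initialPart T n ⊆ initialPart S n := by
  intro j
  simp only [mem_initialPart]
  exact fun hj => ⟨hj.1, h hj.2⟩

theorem card_initialPart (S : Set ℕ) (n : ℕ) :
    (initialPart S n).card = (S ∩ Icc 1 n).ncard := by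
  rw [← ncard_coe_finset]
  congr 1
  ext j
  simp [mem_initialPart, and_comm]

theorem card_initialPart_le (S : Set ℕ) (n : ℕ) : (initialPart S n).card ≤ n := by
  simpa using Finset.card_le_card (initialPart_subset_Icc S n)

/-- The numerator of `∑ j ∈ U, 2 ^ (-j)` over the denominator `2 ^ n`. -/
def dyadicNumerator (n : ℕ) (U : Finset ℕ) : ℕ := ∑ j ∈ U, 2 ^ (n - j)

theorem dyadicNumerator_injOn (n : ℕ) :
    InjOn (dyadicNumerator n) {U | U ⊆ Finset.Icc 1 n} := by
  have hinj : InjOn (fun j => n - j) (Finset.Icc 1 n : Set ℕ) := by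
    intro i hi j hj hij
    simp only [Finset.coe_Icc, mem_Icc] at hi hj hij
    omega
  have hsum : ∀ U ⊆ Finset.Icc 1 n,
      dyadicNumerator n U = ∑ i ∈ U.image (fun j => n - j), 2 ^ i := by
    intro U hU
    rw [Finset.sum_image (hinj.mono (by exact_mod_cast hU))]
    rfl
  intro U hU V hV h
  rw [hsum U hU, hsum V hV] at h
  have h' := Finset.geomSum_injective le_rfl h
  have := congrArg (fun W : Finset ℕ => (W : Set ℕ)) h'
  simp only [Finset.coe_image] at this
  exact_mod_cast (hinj.image_eq_image_iff (by exact_mod_cast hU) (by exact_mod_cast hV)).1 this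

/-- The sum `∑ j ∈ T, 2 ^ (-j)`. -/
noncomputable def binarySum (T : Set ℕ) : ℝ :=
  ∑' j, T.indicator (fun j => ((1 : ℝ) / 2) ^ j) j

theorem binarySum_mem_Icc {T : Set ℕ} (hT : ∀ j ∈ T, 1 ≤ j) (n : ℕ) :
    binarySum T ∈ Icc ((dyadicNumerator n (initialPart T n) : ℝ) * (1 / 2) ^ n)
      (((dyadicNumerator n (initialPart T n) : ℝ) + 1) * (1 / 2) ^ n) := by
  classical
  have hgeom : Summable (fun j : ℕ => ((1 : ℝ) / 2) ^ j) := summable_geometric_two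
  have hs := hgeom.indicator T
  have hnonneg : ∀ j, 0 ≤ T.indicator (fun j => ((1 : ℝ) / 2) ^ j) j :=
    fun j => indicator_nonneg (fun _ _ => by positivity) j
  have hhead : ∑ j ∈ Finset.range (n + 1), T.indicator (fun j => ((1 : ℝ) / 2) ^ j) j =
      (dyadicNumerator n (initialPart T n) : ℝ) * (1 / 2) ^ n := by
    have hU : initialPart T n = {j ∈ Finset.range (n + 1) | j ∈ T} := by
      ext j
      simp only [mem_initialPart, Finset.mem_filter, Finset.mem_range]
      constructor
      · rintro ⟨h, h'⟩
        exact ⟨by omega, h'⟩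
      · rintro ⟨h, h'⟩
        exact ⟨⟨hT j h', by omega⟩, h'⟩
    simp only [indicator_apply]
    rw [← Finset.sum_filter, ← hU, dyadicNumerator, Nat.cast_sum, Finset.sum_mul]
    refine Finset.sum_congr rfl fun j hj => ?_
    obtain ⟨k, rfl⟩ := Nat.exists_eq_add_of_le (mem_initialPart.1 hj).1.2
    simp only [add_tsub_cancel_left, Nat.cast_pow, Nat.cast_ofNat, pow_add]
    rw [mul_left_comm, ← mul_pow]
    norm_num
  have htail : ∑' j, T.indicator (fun j => ((1 : ℝ) / 2) ^ j) (j + (n + 1)) ≤ (1 / 2) ^ n := by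
    have hshift : ∑' j : ℕ, ((1 : ℝ) / 2) ^ (j + (n + 1)) = (1 / 2) ^ n := by
      simp only [pow_add _ _ (n + 1)]
      rw [tsum_mul_right, tsum_geometric_two]
      ring
    rw [← hshift]
    exact Summable.tsum_le_tsum
      (fun j => indicator_le_self' (fun _ _ => by positivity) _)
      ((summable_nat_add_iff (n + 1)).2 hs) ((summable_nat_add_iff (n + 1)).2 hgeom)
  have htail_nonneg : 0 ≤ ∑' j, T.indicator (fun j => ((1 : ℝ) / 2) ^ j) (j + (n + 1)) :=
    tsum_nonneg fun j => hnonneg _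
  have hsplit := hs.sum_add_tsum_nat_add (n + 1)
  rw [hhead] at hsplit
  rw [binarySum, ← hsplit, add_mul, one_mul]
  exact ⟨by linarith, by linarith⟩

/-- Covering bound for the Hausdorff measure of the sums over subsets of `S`. -/
theorem hausdorffMeasure_binarySum_image_le {S : Set ℕ} (hS : ∀ n ∈ S, 1 ≤ n) {d : ℝ}
    (hd : 0 ≤ d) (h : ∃ᶠ n : ℕ in atTop, ((initialPart S n).card : ℝ) ≤ d * n) :
    μH[d] (binarySum '' 𝒫 S) ≤ 1 := by
  have hdiam : ∀ (n : ℕ) (U : Finset ℕ),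
      Metric.ediam (Icc ((dyadicNumerator n U : ℝ) * (1 / 2) ^ n)
        (((dyadicNumerator n U : ℝ) + 1) * (1 / 2) ^ n)) = ENNReal.ofReal ((1 / 2) ^ n) := by
    intro n U
    rw [Real.ediam_Icc]
    congr 1
    ring
  refine (Measure.hausdorffMeasure_le_liminf_sum (β := ℕ) (l := atTop)
    (ι := fun n => {U // U ∈ (initialPart S n).powerset}) d _
    (fun n => ENNReal.ofReal ((1 / 2) ^ n)) ?_
    (fun n U => Icc ((dyadicNumerator n U : ℝ) * (1 / 2) ^ n)
      (((dyadicNumerator n U : ℝ) + 1) * (1 / 2) ^ n))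
    (Eventually.of_forall fun n U => (hdiam n U).le) ?_).trans ?_
  · rw [← ENNReal.ofReal_zero]
    exact ENNReal.tendsto_ofReal
      (tendsto_pow_atTop_nhds_zero_of_lt_one (by norm_num) (by norm_num))
  · refine Eventually.of_forall fun n => ?_
    rintro _ ⟨T, hT, rfl⟩
    exact mem_iUnion.2 ⟨⟨initialPart T n, Finset.mem_powerset.2 (initialPart_mono hT n)⟩,
      binarySum_mem_Icc (fun j hj => hS j (hT hj)) n⟩
  · refine liminf_le_of_frequently_le' (h.mono fun n hn => ?_)
    simp only [hdiam, Finset.sum_const, Finset.card_univ, Fintype.card_coe, Finset.card_powerset,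
      nsmul_eq_mul]
    rw [ENNReal.ofReal_rpow_of_nonneg (by positivity) hd, ← ENNReal.ofReal_natCast,
      ← ENNReal.ofReal_mul (by positivity), ENNReal.ofReal_le_one]
    have h1 : (((2 : ℕ) ^ (initialPart S n).card : ℕ) : ℝ) ≤ 2 ^ (d * n) := by
      push_cast
      rw [← Real.rpow_natCast]
      exact Real.rpow_le_rpow_of_exponent_le (by norm_num) hn
    have h2 : (((1 : ℝ) / 2) ^ n) ^ d = (2 ^ (d * n))⁻¹ := by
      rw [one_div, inv_pow, Real.inv_rpow (by positivity), ← Real.rpow_natCast, ← Real.rpow_mul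
        (by norm_num), mul_comm]
    rw [h2, ← div_eq_mul_inv]
    exact div_le_one_of_le₀ h1 (by positivity)

/-- The fair coin-tossing measure on binary sequences. -/
noncomputable def coinMeasure : Measure (ℕ → Bool) :=
  Measure.infinitePi fun _ => ProbabilityTheory.uniformOn (univ : Set Bool)

instance : IsProbabilityMeasure coinMeasure := by
  have : IsProbabilityMeasure (ProbabilityTheory.uniformOn (univ : Set Bool)) :=
    ProbabilityTheory.isProbabilityMeasure_uniformOn finite_univ univ_nonempty
  unfold coinMeasure
  infer_instance

/-- The random subset of `S` selected by a sequence of coin tosses. -/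
def selected (S : Set ℕ) (ω : ℕ → Bool) : Set ℕ := {j | j ∈ S ∧ ω j = true}

theorem selected_subset (S : Set ℕ) (ω : ℕ → Bool) : selected S ω ⊆ S := fun _ h => h.1

theorem measurable_binarySum_selected (S : Set ℕ) :
    Measurable fun ω => binarySum (selected S ω) := by
  classical
  refine Continuous.measurable (continuous_tsum (u := fun j : ℕ => ((1 : ℝ) / 2) ^ j)
    (fun j => ?_) summable_geometric_two fun j ω => ?_)
  · have : (fun ω => (selected S ω).indicator (fun j => ((1 : ℝ) / 2) ^ j) j) =
        (fun b : Bool => if j ∈ S ∧ b = true then ((1 : ℝ) / 2) ^ j else 0) ∘ fun ω => ω j := by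
      ext ω
      simp [selected, indicator_apply]
    rw [this]
    exact continuous_of_discreteTopology.comp (continuous_apply j)
  · refine (norm_indicator_le_norm_self _ _).trans ?_
    rw [Real.norm_of_nonneg (by positivity)]

theorem coinMeasure_initialPart_selected_eq_le (S : Set ℕ) (n : ℕ) (U : Finset ℕ) :
    coinMeasure {ω | initialPart (selected S ω) n = U} ≤ 2⁻¹ ^ (initialPart S n).card := by
  classical
  have : IsProbabilityMeasure (ProbabilityTheory.uniformOn (univ : Set Bool)) :=
    ProbabilityTheory.isProbabilityMeasure_uniformOn finite_univ univ_nonempty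
  calc
    coinMeasure {ω | initialPart (selected S ω) n = U}
      ≤ coinMeasure (Set.pi (initialPart S n) fun j => {decide (j ∈ U)}) := by
        refine measure_mono ?_
        rintro ω rfl j hj
        have hj' := mem_initialPart.1 (Finset.mem_coe.1 hj)
        simp [mem_initialPart, selected, hj'.1, hj'.2]
    _ = 2⁻¹ ^ (initialPart S n).card := by
        rw [coinMeasure, Measure.infinitePi_pi _ fun _ _ => measurableSet_singleton _]
        simp only [ProbabilityTheory.uniformOn_univ]
        simp

theorem coinMeasure_binarySum_mem_le {S : Set ℕ} (hS : ∀ n ∈ S, 1 ≤ n) (n : ℕ) (a : ℝ) :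
    coinMeasure {ω | binarySum (selected S ω) ∈ Icc a (a + (1 / 2) ^ n)} ≤
      3 * 2⁻¹ ^ (initialPart S n).card := by
  set m₀ := ⌈a * 2 ^ n - 1⌉₊ with hm₀
  have hfiber : ∀ m : ℕ,
      coinMeasure {ω | dyadicNumerator n (initialPart (selected S ω) n) = m} ≤
        2⁻¹ ^ (initialPart S n).card := by
    intro m
    rcases eq_empty_or_nonempty {ω | dyadicNumerator n (initialPart (selected S ω) n) = m} with
      h | ⟨ω₀, h₀⟩
    · simp [h]
    · refine (measure_mono fun ω hω => ?_).trans
        (coinMeasure_initialPart_selected_eq_le S n (initialPart (selected S ω₀) n))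
      exact dyadicNumerator_injOn n (initialPart_subset_Icc _ n) (initialPart_subset_Icc _ n)
        (hω.trans h₀.symm)
  calc
    coinMeasure {ω | binarySum (selected S ω) ∈ Icc a (a + (1 / 2) ^ n)}
      ≤ coinMeasure (⋃ m ∈ Finset.Icc m₀ (m₀ + 2),
          {ω | dyadicNumerator n (initialPart (selected S ω) n) = m}) := by
        refine measure_mono fun ω hω => ?_
        have hx := binarySum_mem_Icc (fun j hj => hS j (selected_subset S ω hj)) n
        simp only [mem_ofPred_eq, mem_Icc] at hω hx
        set N := dyadicNumerator n (initialPart (selected S ω) n)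
        have hpos : (0 : ℝ) < 2 ^ n := by positivity
        have hcancel : ((1 : ℝ) / 2) ^ n * 2 ^ n = 1 := by
          rw [← mul_pow]; norm_num
        have hlow : a * 2 ^ n ≤ N + 1 := by
          have := mul_le_mul_of_nonneg_right (hω.1.trans hx.2) hpos.le
          rwa [mul_assoc, hcancel, mul_one] at this
        have hhigh : (N : ℝ) ≤ a * 2 ^ n + 1 := by
          have := mul_le_mul_of_nonneg_right (hx.1.trans hω.2) hpos.le
          rwa [mul_assoc, hcancel, mul_one, add_mul, hcancel] at this
        have h1 : m₀ ≤ N := Nat.ceil_le.2 (by linarith)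
        have h2 : N ≤ m₀ + 2 := by
          have := Nat.le_ceil (a * 2 ^ n - 1)
          rw [← hm₀] at this
          exact_mod_cast (by linarith : (N : ℝ) ≤ m₀ + 2)
        simp only [mem_iUnion]
        exact ⟨N, Finset.mem_Icc.2 ⟨h1, h2⟩, rfl⟩
    _ ≤ ∑ m ∈ Finset.Icc m₀ (m₀ + 2),
          coinMeasure {ω | dyadicNumerator n (initialPart (selected S ω) n) = m} :=
        measure_biUnion_finset_le _ _
    _ ≤ ∑ _m ∈ Finset.Icc m₀ (m₀ + 2), 2⁻¹ ^ (initialPart S n).card :=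
        Finset.sum_le_sum fun m _ => hfiber m
    _ = 3 * 2⁻¹ ^ (initialPart S n).card := by
        simp [Nat.card_Icc, show m₀ + 2 + 1 - m₀ = 3 by omega]

/-- Mass distribution bound for the Hausdorff measure of the sums over subsets of `S`. -/
theorem hausdorffMeasure_binarySum_image_ne_zero {S : Set ℕ} (hS : ∀ n ∈ S, 1 ≤ n) {d d' : ℝ}
    (hd : 0 < d) (hdd' : d < d')
    (h : ∀ᶠ n : ℕ in atTop, d' * n ≤ ((initialPart S n).card : ℝ)) :
    μH[d] (binarySum '' 𝒫 S) ≠ 0 := by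
  have hscale : ∀ᶠ n : ℕ in atTop, (3 : ℝ≥0∞) * 2⁻¹ ^ (initialPart S n).card ≤
      ENNReal.ofReal (((1 / 2) ^ (n + 1)) ^ d) := by
    have hlim : Tendsto (fun n : ℕ => (d' - d) * n) atTop atTop :=
      tendsto_natCast_atTop_atTop.const_mul_atTop (by linarith)
    filter_upwards [h, hlim.eventually_ge_atTop (2 + d)] with n hn hn'
    have hleft : (3 : ℝ≥0∞) * 2⁻¹ ^ (initialPart S n).card =
        ENNReal.ofReal (3 * (1 / 2) ^ (initialPart S n).card) := by
      rw [ENNReal.ofReal_mul (by norm_num), ENNReal.ofReal_pow (by norm_num), one_div,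
        ENNReal.ofReal_inv_of_pos (by norm_num)]
      norm_num
    rw [hleft]
    refine ENNReal.ofReal_le_ofReal ?_
    have hright : (((1 : ℝ) / 2) ^ (n + 1)) ^ d = (1 / 2) ^ ((n + 1) * d) := by
      rw [← Real.rpow_natCast, ← Real.rpow_mul (by norm_num)]
      push_cast
      rfl
    rw [hright]
    calc
      (3 : ℝ) * (1 / 2) ^ (initialPart S n).card
        ≤ (1 / 2) ^ (-2 : ℝ) * (1 / 2) ^ ((initialPart S n).card : ℝ) := by
          rw [Real.rpow_natCast]
          gcongr
          rw [show (-2 : ℝ) = ((-2 : ℤ) : ℝ) by norm_num, Real.rpow_intCast]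
          norm_num
      _ = (1 / 2) ^ (-2 + ((initialPart S n).card : ℝ)) := by
          rw [Real.rpow_add (by norm_num)]
      _ ≤ (1 / 2) ^ ((n + 1) * d) := by
          refine Real.rpow_le_rpow_of_exponent_ge (by norm_num) (by norm_num) ?_
          linarith
  obtain ⟨N, hN⟩ := eventually_atTop.1 hscale
  have hmeas := measurable_binarySum_selected S
  have hle : coinMeasure.map (fun ω => binarySum (selected S ω)) ≤ μH[d] := by
    refine Measure.le_hausdorffMeasure d _ (ENNReal.ofReal ((1 / 2) ^ N))
      (ENNReal.ofReal_pos.2 (by positivity)) fun s hs => ?_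
    have hbdd : Bornology.IsBounded s :=
      Metric.isBounded_iff_ediam_ne_top.2 (ne_top_of_le_ne_top ENNReal.ofReal_ne_top hs)
    have hcover : ∀ n ≥ N, sSup s - sInf s ≤ (1 / 2) ^ n →
        coinMeasure.map (fun ω => binarySum (selected S ω)) s ≤
          ENNReal.ofReal (((1 / 2) ^ (n + 1)) ^ d) := by
      intro n hn hsn
      refine (measure_mono (t := Icc (sInf s) (sInf s + (1 / 2) ^ n)) fun x hx => ?_).trans ?_
      · have := le_csSup hbdd.bddAbove hx
        exact ⟨csInf_le hbdd.bddBelow hx, by linarith⟩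
      · rw [Measure.map_apply hmeas measurableSet_Icc]
        exact (coinMeasure_binarySum_mem_le hS n (sInf s)).trans (hN n hn)
    rw [Real.ediam_eq hbdd] at hs ⊢
    have hs' : sSup s - sInf s ≤ (1 / 2) ^ N :=
      (ENNReal.ofReal_le_ofReal_iff (by positivity)).1 hs
    rcases le_or_gt (sSup s - sInf s) 0 with hδ | hδ
    · have hlim : Tendsto (fun n : ℕ => ENNReal.ofReal ((((1 : ℝ) / 2) ^ (n + 1)) ^ d)) atTop
          (nhds 0) := by
        have h1 : Tendsto (fun n : ℕ => ((1 : ℝ) / 2) ^ (n + 1)) atTop (nhds 0) :=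
          (tendsto_pow_atTop_nhds_zero_of_lt_one (by norm_num) (by norm_num)).comp
            (tendsto_add_atTop_nat 1)
        have h2 := ENNReal.tendsto_ofReal (h1.rpow_const (p := d) (Or.inr hd.le))
        rwa [Real.zero_rpow hd.ne', ENNReal.ofReal_zero] at h2
      exact (ge_of_tendsto hlim ((eventually_ge_atTop N).mono fun n hn =>
        hcover n hn (hδ.trans (by positivity)))).trans zero_le
    · obtain ⟨n, hn1, hn2⟩ := exists_nat_pow_near_of_lt_one hδ
        (hs'.trans (pow_le_one₀ (by norm_num) (by norm_num)))
        (by norm_num : (0 : ℝ) < 1 / 2) (by norm_num)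
      have hn : N ≤ n := by
        have := (pow_lt_pow_iff_right_of_lt_one₀ (by norm_num) (by norm_num)).1
          (hn1.trans_le hs')
        omega
      refine (hcover n hn hn2).trans ?_
      rw [ENNReal.ofReal_rpow_of_pos hδ]
      gcongr
  have hone : (1 : ℝ≥0∞) ≤ μH[d] (binarySum '' 𝒫 S) := by
    calc
      (1 : ℝ≥0∞) = coinMeasure ((fun ω => binarySum (selected S ω)) ⁻¹' (binarySum '' 𝒫 S)) := by
        rw [← measure_univ (μ := coinMeasure)]
        congr 1
        ext ω
        simpa using ⟨selected S ω, selected_subset S ω, rfl⟩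
      _ ≤ coinMeasure.map (fun ω => binarySum (selected S ω)) (binarySum '' 𝒫 S) :=
        Measure.le_map_apply hmeas.aemeasurable _
      _ ≤ μH[d] (binarySum '' 𝒫 S) := hle _
  exact (zero_lt_one.trans_le hone).ne'

theorem dimH_binary_digit_set_eq_lower_density
    (S : Set ℕ) (hS : ∀ n ∈ S, 1 ≤ n)
    (A : Set ℝ)
    (hA : A = {x : ℝ | ∃ T : Set ℕ, T ⊆ S ∧ x = ∑' j : T, ((1 : ℝ) / 2) ^ (j : ℕ)}) :
    dimH A = ENNReal.ofReal
      (liminf (fun n : ℕ => ((S ∩ Icc 1 n).ncard : ℝ) / n) atTop) := by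
  have hA' : A = binarySum '' 𝒫 S := by
    rw [hA]
    ext x
    simp only [mem_ofPred_eq, mem_image, mem_powerset_iff, binarySum]
    refine exists_congr fun T => and_congr_right fun _ => ?_
    rw [tsum_subtype T (fun j => ((1 : ℝ) / 2) ^ j), eq_comm]
  rw [hA']
  simp only [← card_initialPart]
  set u : ℕ → ℝ := fun n => ((initialPart S n).card : ℝ) / n
  have hu0 : ∀ n, 0 ≤ u n := fun n => by positivity
  have hu1 : ∀ n, u n ≤ 1 := fun n =>
    div_le_one_of_le₀ (by exact_mod_cast card_initialPart_le S n) (by positivity)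
  have hbdd : atTop.IsBoundedUnder (· ≥ ·) u := isBoundedUnder_of ⟨0, hu0⟩
  have hcobdd : atTop.IsCoboundedUnder (· ≥ ·) u :=
    (isBoundedUnder_of ⟨1, hu1⟩ : atTop.IsBoundedUnder (· ≤ ·) u).isCoboundedUnder_ge
  apply le_antisymm
  · refine dimH_le fun d hd => ?_
    by_contra! hlt
    rw [← ENNReal.ofReal_coe_nnreal, ENNReal.ofReal_lt_ofReal_iff_of_nonneg
      (le_liminf_of_le hcobdd (Eventually.of_forall hu0))] at hlt
    have hfreq : ∃ᶠ n : ℕ in atTop, ((initialPart S n).card : ℝ) ≤ d * n := by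
      refine ((frequently_lt_of_liminf_lt hcobdd hlt).and_eventually
        (eventually_gt_atTop 0)).mono ?_
      rintro n ⟨hn, hpos⟩
      exact ((div_lt_iff₀ (by exact_mod_cast hpos)).1 hn).le
    have hle := hausdorffMeasure_binarySum_image_le hS d.coe_nonneg hfreq
    rw [hd] at hle
    exact absurd hle (by simp)
  · refine le_of_forall_lt fun e he => ?_
    obtain ⟨d, hed, hd⟩ := ENNReal.lt_iff_exists_nnreal_btwn.1 he
    have hdL : (d : ℝ) < liminf u atTop := by
      rw [← ENNReal.ofReal_coe_nnreal] at hd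
      exact (ENNReal.ofReal_lt_ofReal_iff_of_nonneg d.coe_nonneg).1 hd
    have hdpos : (0 : ℝ) < d := by
      have : (0 : ℝ≥0∞) < d := zero_le.trans_lt hed
      exact_mod_cast this
    obtain ⟨d', hdd', hd'⟩ := exists_between hdL
    have hev : ∀ᶠ n : ℕ in atTop, d' * n ≤ ((initialPart S n).card : ℝ) := by
      filter_upwards [eventually_lt_of_lt_liminf hd' hbdd, eventually_gt_atTop 0] with n hn hpos
      exact ((lt_div_iff₀ (by exact_mod_cast hpos)).1 hn).le
    exact hed.trans_le (le_dimH_of_hausdorffMeasure_ne_zero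
      (hausdorffMeasure_binarySum_image_ne_zero hS hdpos hdd' hev))
end

section
/- Let i ≥ 1 be an integer and let 0 < α_1 ≤ α_2 ≤ ... ≤ α_i < 1. Then there exists a nonempty compact set A ⊆ [0,1] such that for every j with 1 ≤ j ≤ i the j-fold sumset A_j has Hausdorff dimension α_j, and moreover H^{α_1}(A) = ∞. -/
open MeasureTheory Set Filter
open scoped ENNReal

/-- The product of the first `n` terms of the sequence of bases `B`. -/
def radixProd (B : ℕ → ℕ) (n : ℕ) : ℕ := ∏ m ∈ Finset.range n, B m

/-- The integer with mixed-radix digits `d 0, …, d (n - 1)`, most significant digit first. -/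
def radixPartial (B d : ℕ → ℕ) : ℕ → ℕ
  | 0 => 0
  | n + 1 => B n * radixPartial B d n + d n

/-- The real number with fractional mixed-radix digits `d`. -/
noncomputable def radixValue (B d : ℕ → ℕ) : ℝ := ∑' m, (d m : ℝ) / radixProd B (m + 1)

/-- The numbers whose mixed-radix digits are bounded by `c`. -/
def digitSet (B c : ℕ → ℕ) : Set ℝ := radixValue B '' {d | ∀ m, d m ≤ c m}

lemma radixProd_succ (B : ℕ → ℕ) (n : ℕ) : radixProd B (n + 1) = radixProd B n * B n :=
  Finset.prod_range_succ _ _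

lemma radixProd_pos {B : ℕ → ℕ} (hB : ∀ m, 0 < B m) (n : ℕ) : 0 < radixProd B n :=
  Finset.prod_pos fun m _ => hB m

lemma sum_range_div_radixProd {B : ℕ → ℕ} (hB : ∀ m, 0 < B m) (d : ℕ → ℕ) (n : ℕ) :
    ∑ m ∈ Finset.range n, (d m : ℝ) / radixProd B (m + 1) =
      radixPartial B d n / radixProd B n := by
  induction n with
  | zero => simp [radixPartial]
  | succ n ih =>
    have h1 : (0 : ℝ) < radixProd B n := by exact_mod_cast radixProd_pos hB n
    have h2 : (0 : ℝ) < B n := by exact_mod_cast hB n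
    rw [Finset.sum_range_succ, ih, radixProd_succ, radixPartial]
    push_cast
    field_simp

lemma antitone_radixPartial_add_one_div {B d : ℕ → ℕ} (hd : ∀ m, d m < B m) :
    Antitone fun n => ((radixPartial B d n : ℝ) + 1) / radixProd B n := by
  have hB : ∀ m, 0 < B m := fun m => (Nat.zero_le _).trans_lt (hd m)
  refine antitone_nat_of_succ_le fun n => ?_
  have h1 : (0 : ℝ) < radixProd B n := by exact_mod_cast radixProd_pos hB n
  have h2 : (0 : ℝ) < B n := by exact_mod_cast hB n
  have h3 : (d n : ℝ) + 1 ≤ B n := by exact_mod_cast hd n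
  rw [radixProd_succ, radixPartial, div_le_div_iff₀ (by push_cast; positivity) h1]
  push_cast
  nlinarith

lemma sum_range_div_radixProd_le {B d : ℕ → ℕ} (hd : ∀ m, d m < B m) (n k : ℕ) :
    ∑ m ∈ Finset.range k, (d m : ℝ) / radixProd B (m + 1) ≤
      (radixPartial B d n + 1) / radixProd B n := by
  have hB : ∀ m, 0 < B m := fun m => (Nat.zero_le _).trans_lt (hd m)
  have hle : ∀ m, (radixPartial B d m : ℝ) / radixProd B m ≤
      (radixPartial B d m + 1) / radixProd B m := fun m => by gcongr; linarith
  rcases le_total n k with h | h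
  · rw [sum_range_div_radixProd hB]
    exact (hle k).trans (antitone_radixPartial_add_one_div hd h)
  · refine le_trans ?_ (hle n)
    rw [← sum_range_div_radixProd hB]
    exact Finset.sum_le_sum_of_subset_of_nonneg (Finset.range_mono h) fun _ _ _ => by positivity

lemma summable_div_radixProd {B d : ℕ → ℕ} (hd : ∀ m, d m < B m) :
    Summable fun m => (d m : ℝ) / radixProd B (m + 1) :=
  summable_of_sum_range_le (fun _ => by positivity) (sum_range_div_radixProd_le hd 0)

lemma radixPartial_div_le_radixValue {B d : ℕ → ℕ} (hd : ∀ m, d m < B m) (n : ℕ) :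
    (radixPartial B d n : ℝ) / radixProd B n ≤ radixValue B d := by
  rw [← sum_range_div_radixProd (fun m => (Nat.zero_le _).trans_lt (hd m))]
  exact (summable_div_radixProd hd).sum_le_tsum _ fun _ _ => by positivity

lemma radixValue_le {B d : ℕ → ℕ} (hd : ∀ m, d m < B m) (n : ℕ) :
    radixValue B d ≤ (radixPartial B d n + 1) / radixProd B n :=
  Real.tsum_le_of_sum_range_le (fun _ => by positivity) (sum_range_div_radixProd_le hd n)

lemma digitSet_subset_Icc {B c : ℕ → ℕ} (hc : ∀ m, c m < B m) : digitSet B c ⊆ Icc 0 1 := by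
  rintro _ ⟨d, hd, rfl⟩
  have hd' : ∀ m, d m < B m := fun m => (hd m).trans_lt (hc m)
  have h1 := radixPartial_div_le_radixValue hd' 0
  have h2 := radixValue_le hd' 0
  simp only [radixPartial, radixProd, Finset.range_zero, Finset.prod_empty] at h1 h2
  norm_num at h1 h2
  exact ⟨h1, h2⟩

lemma digitSet_nonempty (B c : ℕ → ℕ) : (digitSet B c).Nonempty :=
  ⟨_, 0, fun _ => Nat.zero_le _, rfl⟩

lemma digitSet_eq_range (B c : ℕ → ℕ) :
    digitSet B c = range fun ω : (m : ℕ) → Fin (c m + 1) => radixValue B fun m => ω m := by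
  ext x
  constructor
  · rintro ⟨d, hd, rfl⟩
    exact ⟨fun m => ⟨d m, Nat.lt_succ_of_le (hd m)⟩, rfl⟩
  · rintro ⟨ω, rfl⟩
    exact ⟨_, fun m => Nat.le_of_lt_succ (ω m).2, rfl⟩

lemma continuous_radixValue {B c : ℕ → ℕ} (hc : ∀ m, c m < B m) :
    Continuous fun ω : (m : ℕ) → Fin (c m + 1) => radixValue B fun m => ω m := by
  refine continuous_tsum (fun m => ?_) (summable_div_radixProd hc) fun m ω => ?_
  · exact (continuous_of_discreteTopology (f := fun a : Fin (c m + 1) =>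
      ((a : ℕ) : ℝ) / radixProd B (m + 1))).comp (continuous_apply m)
  · rw [Real.norm_of_nonneg (by positivity)]
    have := Nat.le_of_lt_succ (ω m).2
    gcongr

lemma isCompact_digitSet {B c : ℕ → ℕ} (hc : ∀ m, c m < B m) : IsCompact (digitSet B c) := by
  rw [digitSet_eq_range]
  exact isCompact_range (continuous_radixValue hc)

/-- The digits of an integer are determined by it. -/
lemma radixPartial_inj {B d d' : ℕ → ℕ} (hd : ∀ m, d m < B m) (hd' : ∀ m, d' m < B m) {n : ℕ}
    (h : radixPartial B d n = radixPartial B d' n) : ∀ m < n, d m = d' m := by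
  induction n with
  | zero => simp
  | succ n ih =>
    simp only [radixPartial] at h
    have hq := congrArg (· / B n) h
    have hr := congrArg (· % B n) h
    have hB : 0 < B n := (Nat.zero_le _).trans_lt (hd n)
    simp only [Nat.mul_add_div hB, Nat.div_eq_of_lt (hd n), Nat.div_eq_of_lt (hd' n),
      Nat.mul_add_mod, Nat.mod_eq_of_lt (hd n), Nat.mod_eq_of_lt (hd' n), add_zero] at hq hr
    intro m hm
    rcases Nat.lt_succ_iff_lt_or_eq.1 hm with h | rfl
    · exact ih hq m h
    · exact hr

lemma radixPartial_sum {ι : Type*} (s : Finset ι) (B : ℕ → ℕ) (d : ι → ℕ → ℕ) (n : ℕ) :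
    ∑ l ∈ s, radixPartial B (d l) n = radixPartial B (fun m => ∑ l ∈ s, d l m) n := by
  induction n with
  | zero => simp [radixPartial]
  | succ n ih => simp [radixPartial, Finset.sum_add_distrib, ← Finset.mul_sum, ih]

/-- The integers with `n` digits bounded by `L`. -/
def radixPrefixes (B L : ℕ → ℕ) : ℕ → Finset ℕ
  | 0 => {0}
  | n + 1 => Finset.image₂ (fun a e => B n * a + e) (radixPrefixes B L n)
      (Finset.range (L n + 1))

lemma card_radixPrefixes_le (B L : ℕ → ℕ) (n : ℕ) :
    (radixPrefixes B L n).card ≤ ∏ m ∈ Finset.range n, (L m + 1) := by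
  induction n with
  | zero => simp [radixPrefixes]
  | succ n ih =>
    rw [Finset.prod_range_succ]
    refine Finset.card_image₂_le _ _ _ |>.trans ?_
    rw [Finset.card_range]
    gcongr

lemma radixPartial_mem_radixPrefixes {B L d : ℕ → ℕ} (hd : ∀ m, d m ≤ L m) (n : ℕ) :
    radixPartial B d n ∈ radixPrefixes B L n := by
  induction n with
  | zero => simp [radixPartial, radixPrefixes]
  | succ n ih =>
    exact Finset.mem_image₂_of_mem ih (Finset.mem_range.2 (Nat.lt_succ_of_le (hd n)))

/-- The product of the uniform measures on the digits `0, …, c m`. -/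
noncomputable def digitMeasure (c : ℕ → ℕ) : Measure ((m : ℕ) → Fin (c m + 1)) :=
  Measure.infinitePi fun m => (PMF.uniformOfFintype (Fin (c m + 1))).toMeasure

instance (c : ℕ → ℕ) : IsProbabilityMeasure (digitMeasure c) := by
  unfold digitMeasure; infer_instance

lemma digitMeasure_radixPartial_eq_le {B c : ℕ → ℕ} (hc : ∀ m, c m < B m) (n k : ℕ) :
    digitMeasure c {ω | radixPartial B (fun m => ω m) n = k} ≤
      ENNReal.ofReal (∏ m ∈ Finset.range n, ((c m : ℝ) + 1)⁻¹) := by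
  rcases eq_empty_or_nonempty {ω : (m : ℕ) → Fin (c m + 1) | radixPartial B (fun m => ω m) n = k}
    with h | ⟨ω₀, hω₀⟩
  · simp [h]
  have hlt : ∀ (ω : (m : ℕ) → Fin (c m + 1)) m, (ω m : ℕ) < B m := fun ω m =>
    (Nat.le_of_lt_succ (ω m).2).trans_lt (hc m)
  have hsub : {ω : (m : ℕ) → Fin (c m + 1) | radixPartial B (fun m => ω m) n = k} ⊆
      (Finset.range n : Set ℕ).pi fun m => {ω₀ m} := fun ω hω m hm =>
    Fin.ext (radixPartial_inj (hlt ω) (hlt ω₀) (hω.trans hω₀.symm) m (by simpa using hm))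
  refine (measure_mono hsub).trans ?_
  rw [digitMeasure, Measure.infinitePi_pi _ fun _ _ => MeasurableSet.singleton _,
    ENNReal.ofReal_prod_of_nonneg fun _ _ => by positivity]
  refine (Finset.prod_congr rfl fun m _ => ?_).le
  rw [PMF.toMeasure_apply_singleton _ _ (MeasurableSet.singleton _), PMF.uniformOfFintype_apply,
    ENNReal.ofReal_inv_of_pos (by positivity)]
  simp [ENNReal.ofReal_add]

lemma prod_inv_le {B c : ℕ → ℕ} {β : ℝ} (hB : ∀ m, 0 < B m)
    (hlow : ∀ m, 2 * (B m : ℝ) ^ β ≤ c m + 1) (n : ℕ) :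
    ∏ m ∈ Finset.range n, ((c m : ℝ) + 1)⁻¹ ≤ (2 ^ n * (radixProd B n : ℝ) ^ β)⁻¹ := by
  rw [Finset.prod_inv_distrib]
  have h : (2 : ℝ) ^ n * (radixProd B n : ℝ) ^ β = ∏ m ∈ Finset.range n, 2 * (B m : ℝ) ^ β := by
    rw [Finset.prod_mul_distrib, Finset.prod_const, Finset.card_range, radixProd, Nat.cast_prod,
      Real.finsetProd_rpow _ _ fun _ _ => Nat.cast_nonneg _]
  have hpos : ∀ m, 0 < 2 * (B m : ℝ) ^ β := fun m => by
    have : (0 : ℝ) < B m := by exact_mod_cast hB m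
    positivity
  rw [h]
  exact inv_anti₀ (Finset.prod_pos fun m _ => hpos m)
    (Finset.prod_le_prod (fun m _ => (hpos m).le) fun m _ => hlow m)

lemma map_digitMeasure_le {B c : ℕ → ℕ} {β : ℝ} (hc : ∀ m, c m < B m)
    (hlow : ∀ m, 2 * (B m : ℝ) ^ β ≤ c m + 1) {s : Set ℝ} {n : ℕ}
    (hs : Metric.ediam s ≤ ENNReal.ofReal (1 / radixProd B n)) :
    (digitMeasure c).map (fun ω => radixValue B fun m => ω m) s ≤
      ENNReal.ofReal (4 * (2 ^ n * (radixProd B n : ℝ) ^ β)⁻¹) := by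
  rcases s.eq_empty_or_nonempty with rfl | ⟨x, hx⟩
  · simp
  have hB : ∀ m, 0 < B m := fun m => (Nat.zero_le _).trans_lt (hc m)
  have hP : (0 : ℝ) < radixProd B n := by exact_mod_cast radixProd_pos hB n
  have hsub : s ⊆ Metric.closedBall x (1 / radixProd B n) := fun y hy => by
    have h := (Metric.edist_le_ediam_of_mem hy hx).trans hs
    rwa [edist_dist, ENNReal.ofReal_le_ofReal_iff (by positivity)] at h
  refine (measure_mono hsub).trans ?_
  rw [Measure.map_apply (continuous_radixValue hc).measurable
    Metric.isClosed_closedBall.measurableSet]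
  set a := ⌈radixProd B n * x - 2⌉₊
  have hcover : (fun ω : (m : ℕ) → Fin (c m + 1) => radixValue B fun m => ω m) ⁻¹'
      Metric.closedBall x (1 / radixProd B n) ⊆
      ⋃ k ∈ Finset.Icc a (a + 3), {ω | radixPartial B (fun m => ω m) n = k} := by
    intro ω hω
    have hlt : ∀ m, (ω m : ℕ) < B m := fun m => (Nat.le_of_lt_succ (ω m).2).trans_lt (hc m)
    rw [mem_preimage, Metric.mem_closedBall, Real.dist_eq, abs_le] at hω
    obtain ⟨h1, h2⟩ := hω
    have h3 := radixPartial_div_le_radixValue hlt n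
    have h4 := radixValue_le hlt n
    have h5 := h3.trans (sub_le_iff_le_add.1 h2)
    have h6 : x - 1 / radixProd B n ≤ _ := (by linarith : _ ≤ _).trans h4
    rw [div_le_iff₀ hP] at h5
    rw [le_div_iff₀ hP] at h6
    have h7 : (1 : ℝ) / radixProd B n * radixProd B n = 1 := by field_simp
    have h8 : a ≤ radixPartial B (fun m => ω m) n := Nat.ceil_le.2 (by linarith)
    have h9 : (radixPartial B (fun m => ω m) n : ℝ) ≤ a + 3 := by
      have := Nat.le_ceil (radixProd B n * x - 2)
      linarith
    simp only [mem_iUnion, Finset.mem_Icc, mem_ofPred_eq, exists_prop, exists_eq_right']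
    exact ⟨h8, by exact_mod_cast h9⟩
  calc _ ≤ _ := measure_mono hcover
    _ ≤ ∑ k ∈ Finset.Icc a (a + 3), digitMeasure c {ω | radixPartial B (fun m => ω m) n = k} :=
        measure_biUnion_finset_le _ _
    _ ≤ ∑ _k ∈ Finset.Icc a (a + 3), ENNReal.ofReal ((2 ^ n * (radixProd B n : ℝ) ^ β)⁻¹) :=
        Finset.sum_le_sum fun k _ => (digitMeasure_radixPartial_eq_le hc n k).trans
          (ENNReal.ofReal_le_ofReal (prod_inv_le hB hlow n))
    _ = _ := by
        rw [Finset.sum_const, Nat.card_Icc, ENNReal.ofReal_mul (by norm_num),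
          show a + 3 + 1 - a = 4 by omega]
        simp

theorem hausdorffMeasure_digitSet_eq_top {B c : ℕ → ℕ} {β : ℝ} (hβ : 0 < β) (hβ1 : β ≤ 1)
    (hc : ∀ m, c m < B m) (hlow : ∀ m, 2 * (B m : ℝ) ^ β ≤ c m + 1)
    (hB : Tendsto (fun n => (B n : ℝ) / 2 ^ n) atTop (nhds 0)) :
    μH[β] (digitSet B c) = ∞ := by
  have hB0 : ∀ m, 0 < B m := fun m => (Nat.zero_le _).trans_lt (hc m)
  have hP : ∀ n, (0 : ℝ) < radixProd B n := fun n => by exact_mod_cast radixProd_pos hB0 n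
  set μ := (digitMeasure c).map (fun ω => radixValue B fun m => ω m)
  have hmeas := (continuous_radixValue hc).measurable
  have hone : 1 ≤ μ (digitSet B c) := by
    refine le_trans ?_ (Measure.le_map_apply hmeas.aemeasurable _)
    rw [digitSet_eq_range, preimage_range, measure_univ]
  have key : ∀ K : ℕ, (K : ℝ≥0∞) • μ ≤ μH[β] := by
    intro K
    have hev : ∀ᶠ n in atTop, 4 * K * ((B n : ℝ) / 2 ^ n) ≤ 1 := by
      have := hB.const_mul (4 * K : ℝ)
      rw [mul_zero] at this
      exact this.eventually_le_const one_pos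
    obtain ⟨n₀, hn₀⟩ := eventually_atTop.1 hev
    refine Measure.le_hausdorffMeasure β _ (ENNReal.ofReal (1 / radixProd B n₀))
      (ENNReal.ofReal_pos.2 (by have := hP n₀; positivity)) fun s hs => ?_
    have hfin : Metric.ediam s ≠ ∞ := (hs.trans_lt ENNReal.ofReal_lt_top).ne
    obtain ⟨r, hr0, hr⟩ : ∃ r : ℝ, 0 ≤ r ∧ Metric.ediam s = ENNReal.ofReal r :=
      ⟨_, ENNReal.toReal_nonneg, (ENNReal.ofReal_toReal hfin).symm⟩
    have hbound : ∀ n, r ≤ 1 / radixProd B n → ((K : ℝ≥0∞) • μ) s ≤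
        ENNReal.ofReal (K * (4 * (2 ^ n * (radixProd B n : ℝ) ^ β)⁻¹)) := fun n hn => by
      rw [Measure.smul_apply, smul_eq_mul, ENNReal.ofReal_mul (Nat.cast_nonneg K),
        ENNReal.ofReal_natCast]
      gcongr
      exact map_digitMeasure_le hc hlow (hr ▸ ENNReal.ofReal_le_ofReal hn)
    have hr1 : r ≤ 1 / radixProd B n₀ := by
      rwa [hr, ENNReal.ofReal_le_ofReal_iff (by have := hP n₀; positivity)] at hs
    rw [hr, ENNReal.ofReal_rpow_of_nonneg hr0 hβ.le]
    by_cases hex : ∃ n, n₀ ≤ n ∧ 1 / (radixProd B (n + 1) : ℝ) < r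
    · classical
      obtain ⟨hn, hlt⟩ := Nat.find_spec hex
      set n := Nat.find hex
      have hle : r ≤ 1 / radixProd B n := by
        rcases hn.eq_or_lt with h | h
        · rwa [← h]
        · obtain ⟨m, hm⟩ : ∃ m, n = m + 1 := ⟨n - 1, by omega⟩
          have := Nat.find_min hex (m := m) (by omega)
          push Not at this
          rw [hm]
          exact this (by omega)
      refine (hbound n hle).trans (ENNReal.ofReal_le_ofReal ?_)
      refine le_trans ?_ (Real.rpow_le_rpow (by have := hP (n + 1); positivity) hlt.le hβ.le)
      have hBn : (1 : ℝ) ≤ B n := by exact_mod_cast hB0 n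
      have hBβ : (B n : ℝ) ^ β ≤ B n := by
        simpa using Real.rpow_le_rpow_of_exponent_le hBn hβ1
      have hq := hn₀ n hn
      have hPβ : 0 < (radixProd B n : ℝ) ^ β := Real.rpow_pos_of_pos (hP n) _
      have hBβ0 : 0 < (B n : ℝ) ^ β := Real.rpow_pos_of_pos (by linarith) _
      rw [Real.div_rpow one_pos.le (hP _).le, Real.one_rpow, radixProd_succ, Nat.cast_mul,
        Real.mul_rpow (hP n).le (by linarith), le_div_iff₀ (by positivity)]
      calc _ = 4 * K * ((B n : ℝ) ^ β / 2 ^ n) := by field_simp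
        _ ≤ 4 * K * ((B n : ℝ) / 2 ^ n) := by gcongr
        _ ≤ 1 := hq
    · push Not at hex
      have hlim : Tendsto (fun n : ℕ => ENNReal.ofReal (K * (4 * (1 / 2 : ℝ) ^ (n + 1)))) atTop
          (nhds 0) := by
        rw [← ENNReal.ofReal_zero]
        refine ENNReal.tendsto_ofReal ?_
        have := (((tendsto_pow_atTop_nhds_zero_of_lt_one (r := (1 / 2 : ℝ)) (by norm_num)
          (by norm_num)).comp (tendsto_add_atTop_nat 1)).const_mul 4).const_mul (K : ℝ)
        simpa using this
      refine (ge_of_tendsto hlim ?_).trans bot_le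
      filter_upwards [eventually_ge_atTop n₀] with n hn
      refine (hbound (n + 1) (hex n hn)).trans (ENNReal.ofReal_le_ofReal ?_)
      rw [one_div, inv_pow]
      have h1 : (1 : ℝ) ≤ (radixProd B (n + 1) : ℝ) ^ β :=
        Real.one_le_rpow (by exact_mod_cast radixProd_pos hB0 (n + 1)) hβ.le
      gcongr
      exact le_mul_of_one_le_right (by positivity) h1
  refine ENNReal.eq_top_of_forall_nnreal_le fun q => ?_
  obtain ⟨K, hK⟩ := exists_nat_ge q
  calc (q : ℝ≥0∞) ≤ K := by exact_mod_cast hK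
    _ = K * 1 := (mul_one _).symm
    _ ≤ K * μ (digitSet B c) := by gcongr
    _ = ((K : ℝ≥0∞) • μ) (digitSet B c) := rfl
    _ ≤ _ := key K _

lemma radixProd_mono {B : ℕ → ℕ} (hB : ∀ m, 0 < B m) : Monotone (radixProd B) :=
  monotone_nat_of_le_succ fun n => by
    rw [radixProd_succ]
    exact Nat.le_mul_of_pos_right _ (hB n)

lemma radixProd_pow_le {B : ℕ → ℕ} (hB : Monotone B) (N K : ℕ) :
    radixProd B N ^ K ≤ radixProd B (K * N) := by
  induction K with
  | zero => simp [radixProd]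
  | succ K ih =>
    have h : radixProd B (K * N + N) =
        radixProd B (K * N) * ∏ m ∈ Finset.range N, B (K * N + m) :=
      Finset.prod_range_add _ _ _
    rw [Nat.succ_mul, h, pow_succ]
    exact Nat.mul_le_mul ih (Finset.prod_le_prod' fun m _ => hB (Nat.le_add_left _ _))

lemma factorial_le_radixProd {B : ℕ → ℕ} (hB : ∀ m, m + 2 ≤ B m) (n : ℕ) :
    n.factorial ≤ radixProd B n := by
  rw [← Finset.prod_range_add_one_eq_factorial]
  exact Finset.prod_le_prod' fun m _ => by have := hB m; omega

lemma eventually_pow_le_radixProd_rpow {B : ℕ → ℕ} (hB : ∀ m, m + 2 ≤ B m) {a ε : ℝ}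
    (ha : 0 < a) (hε : 0 < ε) : ∀ᶠ M in atTop, a ^ M ≤ (radixProd B M : ℝ) ^ ε := by
  filter_upwards [(FloorSemiring.tendsto_pow_div_factorial_atTop (a ^ ε⁻¹)).eventually_le_const
    one_pos] with M hM
  rw [div_le_one (by positivity)] at hM
  have h : (a ^ ε⁻¹) ^ M ≤ (radixProd B M : ℝ) :=
    hM.trans (by exact_mod_cast factorial_le_radixProd hB M)
  calc a ^ M = ((a ^ ε⁻¹) ^ M) ^ ε := by
        rw [← Real.rpow_natCast, ← Real.rpow_natCast, ← Real.rpow_mul ha.le, ← Real.rpow_mul ha.le]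
        congr 1
        field_simp
    _ ≤ _ := Real.rpow_le_rpow (by positivity) h hε.le

lemma radixProd_le_rpow {B : ℕ → ℕ} (hB : Monotone B) (hB0 : ∀ m, 0 < B m) {ε : ℝ} (hε : 0 < ε)
    {K N M : ℕ} (hK : ε⁻¹ ≤ K) (h : K * N ≤ M) :
    (radixProd B N : ℝ) ≤ (radixProd B M : ℝ) ^ ε := by
  have h1 : (radixProd B N : ℝ) ^ K ≤ radixProd B M := by
    exact_mod_cast (radixProd_pow_le hB N K).trans (radixProd_mono hB0 h)
  have h2 : (1 : ℝ) ≤ radixProd B N := by exact_mod_cast radixProd_pos hB0 N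
  have h3 : 1 ≤ K * ε := by
    rw [inv_le_iff_one_le_mul₀ hε] at hK
    exact hK
  calc (radixProd B N : ℝ) = (radixProd B N : ℝ) ^ (1 : ℝ) := (Real.rpow_one _).symm
    _ ≤ (radixProd B N : ℝ) ^ (K * ε) := Real.rpow_le_rpow_of_exponent_le h2 h3
    _ = ((radixProd B N : ℝ) ^ K) ^ ε := by
        rw [Real.rpow_mul (by positivity), Real.rpow_natCast]
    _ ≤ _ := Real.rpow_le_rpow (by positivity) h1 hε.le

lemma prod_le_of_le_on_Ico {B L : ℕ → ℕ} {a β : ℝ} (hB0 : ∀ m, 0 < B m) (ha : 0 ≤ a)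
    (hβ : 0 ≤ β) {N M : ℕ} (hNM : N ≤ M) (hL : ∀ m, (L m : ℝ) + 1 ≤ a * B m)
    (hL' : ∀ m, N ≤ m → m < M → (L m : ℝ) + 1 ≤ a * (B m : ℝ) ^ β) :
    ∏ m ∈ Finset.range M, ((L m : ℝ) + 1) ≤
      a ^ M * radixProd B N * (radixProd B M : ℝ) ^ β := by
  have hB1 : ∀ m, (1 : ℝ) ≤ B m := fun m => by exact_mod_cast hB0 m
  have hN : ∏ m ∈ Finset.range M, (if m < N then (B m : ℝ) else 1) = radixProd B N := by
    rw [Finset.prod_ite, Finset.prod_const_one, mul_one, radixProd, Nat.cast_prod]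
    refine Finset.prod_congr ?_ fun _ _ => rfl
    ext m
    simp only [Finset.mem_filter, Finset.mem_range]
    omega
  calc _ ≤ ∏ m ∈ Finset.range M, a * (if m < N then (B m : ℝ) else 1) * (B m : ℝ) ^ β := by
        refine Finset.prod_le_prod (fun _ _ => by positivity) fun m hm => ?_
        split_ifs with h
        · refine (hL m).trans (le_mul_of_one_le_right (by positivity) ?_)
          exact Real.one_le_rpow (hB1 m) hβ
        · rw [mul_one]
          exact hL' m (not_lt.1 h) (Finset.mem_range.1 hm)
    _ = _ := by
        rw [Finset.prod_mul_distrib, Finset.prod_mul_distrib, hN, Finset.prod_const,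
          Finset.card_range, Real.finsetProd_rpow _ _ fun _ _ => Nat.cast_nonneg _, radixProd,
          radixProd, Nat.cast_prod, Nat.cast_prod]

theorem dimH_sum_digitSet_le {ι : Type*} [Fintype ι] [Nonempty ι] {B : ℕ → ℕ} {c : ι → ℕ → ℕ}
    {β : ℝ} (hB : Monotone B) (hB2 : ∀ m, m + 2 ≤ B m) (hβ : 0 ≤ β) (hc : ∀ l m, c l m < B m)
    (hfreq : ∀ K : ℕ, ∃ᶠ M in atTop, ∃ N ≤ M, K * N ≤ M ∧
      ∀ m, N ≤ m → m < M → ∀ l, (c l m : ℝ) + 1 ≤ 4 * (B m : ℝ) ^ β) :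
    dimH {x : ℝ | ∃ y : ι → ℝ, (∀ l, y l ∈ digitSet B (c l)) ∧ ∑ l, y l = x} ≤
      ENNReal.ofReal β := by
  set Y := {x : ℝ | ∃ y : ι → ℝ, (∀ l, y l ∈ digitSet B (c l)) ∧ ∑ l, y l = x}
  have hB0 : ∀ m, 0 < B m := fun m => by have := hB2 m; omega
  have hP : ∀ n, (0 : ℝ) < radixProd B n := fun n => by exact_mod_cast radixProd_pos hB0 n
  set j : ℝ := (Fintype.card ι : ℝ) with hj
  have hj1 : 1 ≤ j := by rw [hj]; exact_mod_cast Fintype.card_pos (α := ι)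
  set L : ℕ → ℕ := fun m => ∑ l, c l m with hLdef
  let T := radixPrefixes B L
  let cov : (M : ℕ) → T M → Set ℝ := fun M a =>
    Icc ((a : ℕ) / radixProd B M : ℝ) ((a : ℕ) / radixProd B M + j / radixProd B M)
  have hdiam : ∀ M a, Metric.ediam (cov M a) = ENNReal.ofReal (j / radixProd B M) := fun M a => by
    rw [Real.ediam_Icc, add_sub_cancel_left]
  have hcov : ∀ M, Y ⊆ ⋃ a, cov M a := by
    rintro M _ ⟨y, hy, rfl⟩
    choose d hd hdy using hy
    have hlt : ∀ l m, d l m < B m := fun l m => (hd l m).trans_lt (hc l m)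
    have hmem : radixPartial B (fun m => ∑ l, d l m) M ∈ T M :=
      radixPartial_mem_radixPrefixes (fun m => Finset.sum_le_sum fun l _ => hd l m) M
    refine mem_iUnion.2 ⟨⟨_, hmem⟩, ?_⟩
    simp only [cov, mem_Icc, ← radixPartial_sum, Nat.cast_sum, Finset.sum_div]
    constructor
    · exact Finset.sum_le_sum fun l _ => hdy l ▸ radixPartial_div_le_radixValue (hlt l) M
    · have hj' : j / radixProd B M = ∑ _l : ι, 1 / (radixProd B M : ℝ) := by
        simp [hj, div_eq_mul_inv]
      rw [hj', ← Finset.sum_add_distrib]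
      refine Finset.sum_le_sum fun l _ => ?_
      rw [← hdy l, ← add_div]
      exact radixValue_le (hlt l) M
  have hLle : ∀ (m : ℕ) (b : ℝ), 0 ≤ b → (∀ l, (c l m : ℝ) + 1 ≤ b) → (L m : ℝ) + 1 ≤ j * b := by
    intro m b hb h
    calc (L m : ℝ) + 1 ≤ ∑ l, ((c l m : ℝ) + 1) := by
          rw [Finset.sum_add_distrib, hLdef]
          push_cast
          simpa [hj] using hj1
      _ ≤ ∑ _l : ι, b := Finset.sum_le_sum fun l _ => h l
      _ = j * b := by simp [hj]
  have hmain : ∀ ε : ℝ, 0 < ε →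
      ∃ᶠ M in atTop, ((T M).card : ℝ) ≤ (radixProd B M : ℝ) ^ (β + ε) := by
    intro ε hε
    obtain ⟨K, hK⟩ := exists_nat_ge (ε / 2)⁻¹
    refine ((hfreq K).and_eventually (eventually_pow_le_radixProd_rpow hB2
      (a := 4 * j) (ε := ε / 2) (by positivity) (by positivity))).mono ?_
    rintro M ⟨⟨N, hNM, hKN, hN⟩, hM⟩
    have hcard : ((T M).card : ℝ) ≤ ∏ m ∈ Finset.range M, ((L m : ℝ) + 1) := by
      exact_mod_cast card_radixPrefixes_le B L M
    refine hcard.trans ((prod_le_of_le_on_Ico (a := 4 * j) (β := β) hB0 (by positivity) hβ hNM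
      (fun m => ?_) fun m h1 h2 => ?_).trans ?_)
    · refine (hLle m (B m) (by positivity) fun l => by exact_mod_cast hc l m).trans ?_
      gcongr
      linarith
    · refine (hLle m _ (by positivity) (hN m h1 h2)).trans_eq (by ring)
    · calc _ ≤ (radixProd B M : ℝ) ^ (ε / 2) * (radixProd B M : ℝ) ^ (ε / 2) *
            (radixProd B M : ℝ) ^ β := by
            gcongr
            exact radixProd_le_rpow hB hB0 (by positivity) hK hKN
        _ = _ := by
            rw [← Real.rpow_add (hP M), ← Real.rpow_add (hP M)]
            congr 1
            ring
  have hr : Tendsto (fun M => ENNReal.ofReal (j / radixProd B M)) atTop (nhds 0) := by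
    rw [← ENNReal.ofReal_zero]
    refine ENNReal.tendsto_ofReal (Tendsto.const_div_atTop ?_ j)
    refine tendsto_atTop_mono (fun M => ?_) tendsto_natCast_atTop_atTop
    exact_mod_cast M.self_le_factorial.trans (factorial_le_radixProd hB2 M)
  have hdim : ∀ ε : ℝ, 0 < ε → dimH Y ≤ ENNReal.ofReal (β + ε) := by
    intro ε hε
    refine dimH_le_of_hausdorffMeasure_ne_top (d := (β + ε).toNNReal) ?_
    rw [Real.coe_toNNReal _ (by positivity)]
    refine (lt_of_le_of_lt (Measure.hausdorffMeasure_le_liminf_sum (β + ε) Y _ hr cov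
      (Eventually.of_forall fun M a => (hdiam M a).le) (Eventually.of_forall hcov))
      (lt_of_le_of_lt (liminf_le_of_frequently_le' (x := ENNReal.ofReal (j ^ (β + ε))) ?_)
        ENNReal.ofReal_lt_top)).ne
    refine (hmain ε hε).mono fun M hM => ?_
    have hPM := hP M
    have hPε : 0 < (radixProd B M : ℝ) ^ (β + ε) := Real.rpow_pos_of_pos hPM _
    simp only [hdiam, Finset.sum_const, Finset.card_univ, Fintype.card_coe, nsmul_eq_mul]
    rw [ENNReal.ofReal_rpow_of_nonneg (by positivity) (by positivity), ← ENNReal.ofReal_natCast,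
      ← ENNReal.ofReal_mul (by positivity), Real.div_rpow (by positivity) hPM.le]
    refine ENNReal.ofReal_le_ofReal ?_
    calc _ ≤ (radixProd B M : ℝ) ^ (β + ε) * (j ^ (β + ε) / (radixProd B M : ℝ) ^ (β + ε)) := by
          gcongr
      _ = _ := by field_simp
  refine ENNReal.le_of_forall_pos_le_add fun ε hε _ => ?_
  refine (hdim ε hε).trans ?_
  rw [ENNReal.ofReal_add hβ ε.coe_nonneg, ENNReal.ofReal_coe_nnreal]

/-- A sequence taking every value on arbitrarily long multiplicative runs. -/
theorem exists_seq_frequently_eq_on_Ico (σ : Type*) [Countable σ] [Nonempty σ] :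
    ∃ J : ℕ → σ, ∀ (s : σ) (K : ℕ), ∃ᶠ M in atTop, ∃ N ≤ M, K * N ≤ M ∧
      ∀ m, N ≤ m → m < M → J m = s := by
  obtain ⟨e, he⟩ := exists_surjective_nat σ
  refine ⟨fun m => e (Nat.unpair (Nat.sqrt (Nat.log 2 m))).1, fun s K => ?_⟩
  obtain ⟨a, rfl⟩ := he s
  rw [frequently_atTop]
  intro M₀
  set t := Nat.pair a (max M₀ K) with ht
  have ht1 : M₀ ≤ t := (le_max_left _ _).trans (Nat.right_le_pair _ _)
  have ht2 : K ≤ t := (le_max_right _ _).trans (Nat.right_le_pair _ _)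
  have hexp : (t + 1) * (t + 1) = (t + (t + 1)) + t * t := by ring
  have hpow : ∀ n, n ≤ 2 ^ n := fun n => Nat.lt_two_pow_self.le
  refine ⟨2 ^ ((t + 1) * (t + 1)), ?_, 2 ^ (t * t), ?_, ?_, fun m h1 h2 => ?_⟩
  · exact ht1.trans ((hpow t).trans (Nat.pow_le_pow_right two_pos (by nlinarith)))
  · exact Nat.pow_le_pow_right two_pos (by nlinarith)
  · rw [hexp, pow_add]
    gcongr
    exact (ht2.trans (hpow t)).trans (Nat.pow_le_pow_right two_pos (by omega))
  · have hm : m ≠ 0 := by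
      have := Nat.two_pow_pos (t * t)
      omega
    have hs : Nat.sqrt (Nat.log 2 m) = t := by
      rw [eq_comm, Nat.eq_sqrt]
      exact ⟨(Nat.le_log_iff_pow_le one_lt_two hm).2 h1, (Nat.log_lt_iff_lt_pow one_lt_two hm).2 h2⟩
    simp [hs, ht]

lemma radixValue_sum {ι : Type*} (s : Finset ι) {B : ℕ → ℕ} {d : ι → ℕ → ℕ}
    (hd : ∀ l m, d l m < B m) :
    ∑ l ∈ s, radixValue B (d l) = radixValue B fun m => ∑ l ∈ s, d l m := by
  simp only [radixValue]
  rw [← Summable.tsum_finsetSum fun l _ => summable_div_radixProd (hd l)]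
  simp [Finset.sum_div]

/-- If each digit bounded by `c` is available to some summand, then the sumset contains
`digitSet B c`. -/
lemma exists_sum_eq_of_mem_digitSet {ι : Type*} [Fintype ι] {B c : ℕ → ℕ} {c' : ι → ℕ → ℕ}
    (hc' : ∀ l m, c' l m < B m) (h : ∀ m, ∃ l, c m ≤ c' l m) {x : ℝ} (hx : x ∈ digitSet B c) :
    ∃ y : ι → ℝ, (∀ l, y l ∈ digitSet B (c' l)) ∧ ∑ l, y l = x := by
  classical
  obtain ⟨d, hd, rfl⟩ := hx
  choose g hg using h
  have hle : ∀ l m, (if l = g m then d m else 0) ≤ c' l m := fun l m => by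
    split_ifs with hl
    · exact hl ▸ (hd m).trans (hg m)
    · exact Nat.zero_le _
  refine ⟨fun l => radixValue B fun m => if l = g m then d m else 0,
    fun l => ⟨_, hle l, rfl⟩, ?_⟩
  rw [radixValue_sum _ fun l m => (hle l m).trans_lt (hc' l m)]
  simp

/-- The digit bound producing dimension `β` in base `b`. -/
noncomputable def digitBound (b : ℕ) (β : ℝ) : ℕ := ⌈2 * (b : ℝ) ^ β⌉₊

lemma digitBound_mono {b : ℕ} (hb : 0 < b) : Monotone (digitBound b) := fun β γ h => by
  have hb1 : (1 : ℝ) ≤ b := by exact_mod_cast hb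
  unfold digitBound
  gcongr

lemma two_mul_rpow_le_digitBound (b : ℕ) (β : ℝ) : 2 * (b : ℝ) ^ β ≤ digitBound b β + 1 :=
  (Nat.le_ceil _).trans (le_add_of_nonneg_right zero_le_one)

lemma digitBound_add_one_le {b : ℕ} (hb : 0 < b) {β : ℝ} (hβ : 0 ≤ β) :
    (digitBound b β : ℝ) + 1 ≤ 4 * (b : ℝ) ^ β := by
  have h1 : (1 : ℝ) ≤ (b : ℝ) ^ β := Real.one_le_rpow (by exact_mod_cast hb) hβ
  have h2 := Nat.ceil_lt_add_one (a := 2 * (b : ℝ) ^ β) (by positivity)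
  rw [digitBound]
  linarith

lemma exists_digitBound_lt {β : ℝ} (hβ : 0 ≤ β) (hβ1 : β < 1) :
    ∃ C : ℕ, ∀ b : ℕ, C ≤ b → digitBound b β < b := by
  have h : Tendsto (fun b : ℕ => (b : ℝ) ^ (1 - β)) atTop atTop :=
    (tendsto_rpow_atTop (by linarith)).comp tendsto_natCast_atTop_atTop
  obtain ⟨C, hC⟩ := eventually_atTop.1 ((h.eventually_ge_atTop 4).and (eventually_ge_atTop 1))
  refine ⟨C, fun b hb => ?_⟩
  obtain ⟨h1, h2⟩ := hC b hb
  have hb0 : (0 : ℝ) < b := by exact_mod_cast h2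
  have h3 := digitBound_add_one_le h2 hβ
  have h4 : (b : ℝ) = (b : ℝ) ^ β * (b : ℝ) ^ (1 - β) := by
    rw [← Real.rpow_add hb0]
    simp
  have h5 : 0 < (b : ℝ) ^ β := Real.rpow_pos_of_pos hb0 _
  have h6 : (digitBound b β : ℝ) + 1 ≤ b := by nlinarith
  exact_mod_cast h6

lemma tendsto_add_const_div_two_pow (C : ℕ) :
    Tendsto (fun n : ℕ => ((n + C : ℕ) : ℝ) / 2 ^ n) atTop (nhds 0) := by
  have h1 := tendsto_pow_const_div_const_pow_of_one_lt 1 (r := (2 : ℝ)) one_lt_two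
  have h0 := (tendsto_pow_const_div_const_pow_of_one_lt 0 (r := (2 : ℝ)) one_lt_two).const_mul
    (C : ℝ)
  have h := h1.add h0
  rw [mul_zero, add_zero] at h
  refine h.congr fun n => ?_
  push_cast
  ring

theorem exists_compact_set_finitely_many_prescribed_sumset_dimensions
    (i : ℕ) (hi : 1 ≤ i) (α : ℕ → ℝ)
    (hpos : ∀ j, 1 ≤ j → j ≤ i → 0 < α j)
    (hlt : ∀ j, 1 ≤ j → j ≤ i → α j < 1)
    (hmono : ∀ j k, 1 ≤ j → j ≤ k → k ≤ i → α j ≤ α k) :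
    ∃ A : Set ℝ, A.Nonempty ∧ IsCompact A ∧ A ⊆ Icc (0 : ℝ) 1 ∧
      (∀ j, 1 ≤ j → j ≤ i → dimH (sumSet A j) = ENNReal.ofReal (α j)) ∧
      μH[α 1] A = ∞ := by
  obtain ⟨C, hC⟩ := exists_digitBound_lt (hpos i hi le_rfl).le (hlt i hi le_rfl)
  obtain ⟨J, hJ⟩ := exists_seq_frequently_eq_on_Ico (Finset (Fin i))
  set B : ℕ → ℕ := fun m => m + (C + 2) with hBdef
  have hB : Monotone B := fun a b h => Nat.add_le_add_right h _
  have hB2 : ∀ m, m + 2 ≤ B m := fun m => by simp only [hBdef]; omega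
  have hB0 : ∀ m, 0 < B m := fun m => by simp only [hBdef]; omega
  have hBlim : Tendsto (fun n => (B n : ℝ) / 2 ^ n) atTop (nhds 0) :=
    tendsto_add_const_div_two_pow (C + 2)
  let β : Fin i → ℕ → ℝ := fun k m => if k ∈ J m then α (J m).card else α i
  let c : Fin i → ℕ → ℕ := fun k m => digitBound (B m) (β k m)
  have hcard_le : ∀ m, (J m).card ≤ i := fun m => by simpa using (J m).card_le_univ
  have hlt_of_le : ∀ m γ, γ ≤ α i → digitBound (B m) γ < B m := fun m γ h =>
    (digitBound_mono (hB0 m) h).trans_lt (hC _ (by simp only [hBdef]; omega))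
  have hc : ∀ k m, c k m < B m := fun k m => by
    refine hlt_of_le m _ ?_
    simp only [β]
    split_ifs with h
    · exact hmono _ _ (Finset.card_pos.2 ⟨k, h⟩) (hcard_le m) le_rfl
    · exact le_rfl
  have hexists : ∀ j (_ : 1 ≤ j) (hji : j ≤ i) m, ∃ l : Fin j, α j ≤ β (Fin.castLE hji l) m := by
    intro j hj hji m
    by_contra! hcon
    have hmem : ∀ l : Fin j, Fin.castLE hji l ∈ J m := fun l => by
      by_contra h
      have := hcon l
      simp only [β, if_neg h] at this
      exact this.not_ge (hmono j i hj hji le_rfl)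
    have hcard : j ≤ (J m).card := by
      simpa using Finset.card_le_card_of_injOn (s := Finset.univ) _ (fun l _ => hmem l)
        (Fin.castLE_injective hji).injOn
    have := hcon ⟨0, hj⟩
    simp only [β, if_pos (hmem _)] at this
    exact this.not_ge (hmono j _ hj hcard (hcard_le m))
  have htop : ∀ j, 1 ≤ j → j ≤ i →
      μH[α j] (digitSet B fun m => digitBound (B m) (α j)) = ∞ := fun j hj hji =>
    hausdorffMeasure_digitSet_eq_top (hpos j hj hji) (hlt j hj hji).le
      (fun m => hlt_of_le m _ (hmono j i hj hji le_rfl))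
      (fun m => two_mul_rpow_le_digitBound _ _) hBlim
  have hsub : ∀ j, 1 ≤ j → j ≤ i →
      (digitSet B fun m => digitBound (B m) (α j)) ⊆ sumSet (⋃ k, digitSet B (c k)) j := by
    intro j hj hji x hx
    obtain ⟨y, hy, rfl⟩ := exists_sum_eq_of_mem_digitSet
      (c' := fun l : Fin j => c (Fin.castLE hji l)) (fun l => hc _)
      (fun m => (hexists j hj hji m).imp fun l hl => digitBound_mono (hB0 m) hl) hx
    exact ⟨y, fun l => mem_iUnion.2 ⟨_, hy l⟩, rfl⟩
  refine ⟨⋃ k, digitSet B (c k), ?_, isCompact_iUnion fun k => isCompact_digitSet (hc k),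
    iUnion_subset fun k => digitSet_subset_Icc (hc k), fun j hj hji => le_antisymm ?_ ?_, ?_⟩
  · obtain ⟨x, hx⟩ := digitSet_nonempty B (c ⟨0, hi⟩)
    exact ⟨x, mem_iUnion.2 ⟨_, hx⟩⟩
  · have hcover : sumSet (⋃ k, digitSet B (c k)) j ⊆ ⋃ f : Fin j → Fin i,
        {x | ∃ y : Fin j → ℝ, (∀ l, y l ∈ digitSet B (c (f l))) ∧ ∑ l, y l = x} := by
      rintro x ⟨y, hy, hyx⟩
      choose f hf using fun l => mem_iUnion.1 (hy l)
      exact mem_iUnion.2 ⟨f, y, hf, hyx⟩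
    refine (dimH_mono hcover).trans ?_
    rw [dimH_iUnion]
    refine iSup_le fun f => ?_
    have : Nonempty (Fin j) := ⟨⟨0, hj⟩⟩
    refine dimH_sum_digitSet_le hB hB2 (hpos j hj hji).le (fun l => hc (f l)) fun K => ?_
    refine (hJ (Finset.univ.image f) K).mono ?_
    rintro M ⟨N, hNM, hKN, h⟩
    refine ⟨N, hNM, hKN, fun m h1 h2 l => ?_⟩
    refine le_trans ?_ (digitBound_add_one_le (hB0 m) (hpos j hj hji).le)
    gcongr
    refine digitBound_mono (hB0 m) ?_
    have hmem : f l ∈ J m := h m h1 h2 ▸ Finset.mem_image_of_mem f (Finset.mem_univ l)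
    simp only [β, if_pos hmem]
    refine hmono _ _ (Finset.card_pos.2 ⟨_, hmem⟩) ?_ hji
    rw [h m h1 h2]
    simpa using Finset.card_image_le (s := Finset.univ) (f := f)
  · refine le_trans ?_ (dimH_mono (hsub j hj hji))
    refine le_dimH_of_hausdorffMeasure_eq_top (d := (α j).toNNReal) ?_
    rw [Real.coe_toNNReal _ (hpos j hj hji).le]
    exact htop j hj hji
  · refine top_unique ((htop 1 le_rfl hi).ge.trans (measure_mono fun x hx => ?_))
    obtain ⟨y, hy, hyx⟩ := hsub 1 le_rfl hi hx
    rw [← hyx, Fin.sum_univ_one]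
    exact hy 0
end

section
/- For every s with 0 < s ≤ 1 there exists a Borel set E ⊆ ℝ of Hausdorff dimension s that is mid-point convex but not convex, satisfying H^s(E) = 0 and H^{s−ε}(E) = ∞ for every ε with 0 < ε < s. -/
open MeasureTheory Set Filter
open scoped ENNReal NNReal Topology Nat

section BinaryExpansions

open Real

theorem two_pow_inv_le_abs_ofDigits_sub_ofDigits {x y : ℕ → Fin 2} {n p : ℕ} (hnp : n < p)
    (h : ∀ i < n, x i = y i) (hn : x n ≠ y n) (hxp : x p = 0) (hyp : y p = 0) :
    ((2 : ℝ) ^ (p + 1))⁻¹ ≤ |ofDigits x - ofDigits y| := by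
  wlog hxy : x n = 0 ∧ y n = 1 generalizing x y
  · rw [abs_sub_comm]
    exact this (fun i hi ↦ (h i hi).symm) hn.symm hyp hxp (by grind)
  obtain ⟨hx0, hy1⟩ := hxy
  set u : ℕ → Fin 2 := Function.update x p 1 with hu
  have hux : ofDigits u = ofDigits x + ((2 : ℝ) ^ (p + 1))⁻¹ := by
    rw [ofDigits_eq_sum_add_ofDigits u (p + 1), ofDigits_eq_sum_add_ofDigits x (p + 1),
      Finset.sum_range_succ, Finset.sum_range_succ]
    have h1 : ∑ i ∈ Finset.range p, ofDigitsTerm u i = ∑ i ∈ Finset.range p, ofDigitsTerm x i :=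
      Finset.sum_congr rfl fun i hi ↦ by
        simp [ofDigitsTerm, hu, Function.update_of_ne (Finset.mem_range.mp hi).ne]
    have h2 : (fun i ↦ u (i + (p + 1))) = fun i ↦ x (i + (p + 1)) := by
      funext i
      exact Function.update_of_ne (by omega) _ _
    have h3 : ofDigitsTerm u p = ((2 : ℝ) ^ (p + 1))⁻¹ := by simp [ofDigitsTerm, hu]
    have h4 : ofDigitsTerm x p = 0 := by simp [ofDigitsTerm, hxp]
    rw [h1, h2, h3, h4]
    ring
  have huy : ofDigits u ≤ ofDigits y := by
    rw [ofDigits_eq_sum_add_ofDigits u (n + 1), ofDigits_eq_sum_add_ofDigits y (n + 1),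
      Finset.sum_range_succ, Finset.sum_range_succ]
    have h1 : ∑ i ∈ Finset.range n, ofDigitsTerm u i = ∑ i ∈ Finset.range n, ofDigitsTerm y i :=
      Finset.sum_congr rfl fun i hi ↦ by
        have hi := Finset.mem_range.mp hi
        simp [ofDigitsTerm, hu, Function.update_of_ne (hi.trans hnp).ne, h i hi]
    have h3 : ofDigitsTerm u n = 0 := by
      simp [ofDigitsTerm, hu, Function.update_of_ne hnp.ne, hx0]
    have h4 : ofDigitsTerm y n = ((2 : ℝ) ^ (n + 1))⁻¹ := by simp [ofDigitsTerm, hy1]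
    have h5 := ofDigits_le_one fun i ↦ u (i + (n + 1))
    have h6 := ofDigits_nonneg fun i ↦ y (i + (n + 1))
    have h7 : (0 : ℝ) < ((2 : ℝ) ^ (n + 1))⁻¹ := by positivity
    rw [h1, h3, h4]
    push_cast
    nlinarith
  rw [abs_sub_comm]
  exact le_trans (by linarith) (le_abs_self _)

/-- The digit sequence carrying the successive terms of `w` at the successive positions
satisfying `P`, and zeros elsewhere. -/
def spreadDigits (P : ℕ → Prop) [DecidablePred P] (w : ℕ → Fin 2) (n : ℕ) : Fin 2 :=
  if P n then w (Nat.count P n) else 0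

theorem eq_of_spreadDigits_eq {P : ℕ → Prop} [DecidablePred P] {w w' : ℕ → Fin 2} {n i : ℕ}
    (h : ∀ j < n, spreadDigits P w j = spreadDigits P w' j) (hi : i < Nat.count P n) :
    w i = w' i := by
  have hf : ∀ hf : (Set.ofPred P).Finite, i < hf.toFinset.card :=
    fun hf ↦ hi.trans_le (Nat.count_le_card hf n)
  have := h _ (Nat.nth_lt_of_lt_count hi)
  simpa [spreadDigits, Nat.nth_mem _ hf, Nat.count_nth hf] using this

theorem abs_ofDigits_sub_le_of_spreadDigits {P : ℕ → Prop} [DecidablePred P] {t c : ℝ} {m : ℕ}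
    (ht : 0 < t) (hcount : ∀ n, t * n - c ≤ Nat.count P n)
    (hgap : ∀ n, ∃ p, n < p ∧ p ≤ n + m ∧ ¬ P p) (w w' : ℕ → Fin 2) :
    |ofDigits w - ofDigits w'| ≤ 2 ^ (c + t * (m + 1)) *
      |ofDigits (spreadDigits P w) - ofDigits (spreadDigits P w')| ^ t := by
  by_cases heq : ∀ n, spreadDigits P w n = spreadDigits P w' n
  · have : w = w' := by
      funext i
      obtain ⟨n, hn⟩ := exists_nat_gt ((i + c) / t)
      refine eq_of_spreadDigits_eq (P := P) (n := n) (fun j _ ↦ heq j) ?_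
      rw [div_lt_iff₀ ht] at hn
      have := hcount n
      exact_mod_cast (by linarith : (i : ℝ) < Nat.count P n)
    subst this
    simp only [sub_self, abs_zero]
    positivity
  push Not at heq
  classical
  set n := Nat.find heq with hn
  have hne : spreadDigits P w n ≠ spreadDigits P w' n := Nat.find_spec heq
  have hlt : ∀ j < n, spreadDigits P w j = spreadDigits P w' j := fun j hj ↦ by
    simpa using Nat.find_min heq hj
  obtain ⟨p, hnp, hpm, hp⟩ := hgap n
  have hlow := two_pow_inv_le_abs_ofDigits_sub_ofDigits hnp hlt hne
    (by simp [spreadDigits, hp]) (by simp [spreadDigits, hp])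
  have hup := abs_ofDigits_sub_ofDigits_le fun i hi ↦ eq_of_spreadDigits_eq hlt hi
  have hbound : (2 : ℝ) ^ (-((n : ℝ) + m + 1)) ≤
      |ofDigits (spreadDigits P w) - ofDigits (spreadDigits P w')| := by
    refine le_trans ?_ hlow
    rw [← Real.rpow_natCast, ← Real.rpow_neg zero_le_two]
    refine Real.rpow_le_rpow_of_exponent_le one_le_two ?_
    have : (p : ℝ) ≤ n + m := by exact_mod_cast hpm
    push_cast
    linarith
  calc |ofDigits w - ofDigits w'| ≤ ((2 : ℝ) ^ Nat.count P n)⁻¹ := by exact_mod_cast hup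
    _ = (2 : ℝ) ^ (-(Nat.count P n : ℝ)) := by
        rw [Real.rpow_neg zero_le_two, Real.rpow_natCast]
    _ ≤ (2 : ℝ) ^ (c + t * (m + 1) + -((n : ℝ) + m + 1) * t) := by
        refine Real.rpow_le_rpow_of_exponent_le one_le_two ?_
        have := hcount n
        linarith
    _ = 2 ^ (c + t * (m + 1)) * ((2 : ℝ) ^ (-((n : ℝ) + m + 1))) ^ t := by
        rw [Real.rpow_add two_pos, Real.rpow_mul zero_le_two]
    _ ≤ _ := by gcongr

theorem hausdorffMeasure_range_ofDigits_spreadDigits_ne_zero {P : ℕ → Prop} [DecidablePred P]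
    {t c : ℝ} {m : ℕ} (ht : 0 < t) (hcount : ∀ n, t * n - c ≤ Nat.count P n)
    (hgap : ∀ n, ∃ p, n < p ∧ p ≤ n + m ∧ ¬ P p) :
    μH[t] (range fun w : ℕ → Fin 2 ↦ ofDigits (spreadDigits P w)) ≠ 0 := by
  set g : (ℕ → Fin 2) → ℝ := fun w ↦ ofDigits (spreadDigits P w)
  set f : ℝ → ℝ := fun x ↦ ofDigits (Function.invFun g x)
  have hbd := abs_ofDigits_sub_le_of_spreadDigits ht hcount hgap
  have hfg : ∀ w, f (g w) = ofDigits w := fun w ↦ by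
    have hw : g (Function.invFun g (g w)) = g w := Function.invFun_eq ⟨w, rfl⟩
    have := hbd (Function.invFun g (g w)) w
    rw [show ofDigits (spreadDigits P (Function.invFun g (g w))) = ofDigits (spreadDigits P w)
      from hw, sub_self, abs_zero, Real.zero_rpow ht.ne', mul_zero] at this
    exact sub_eq_zero.1 (abs_nonpos_iff.1 this)
  lift t to ℝ≥0 using ht.le
  have hH : HolderOnWith ((2 : ℝ≥0) ^ (c + t * (m + 1))) t f (range g) := by
    rintro _ ⟨w, rfl⟩ _ ⟨w', rfl⟩
    rw [hfg, hfg, edist_dist, edist_dist, Real.dist_eq, Real.dist_eq,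
      ENNReal.ofReal_rpow_of_nonneg (abs_nonneg _) t.coe_nonneg, ← ENNReal.ofReal_coe_nnreal,
      ← ENNReal.ofReal_mul (by positivity)]
    exact ENNReal.ofReal_le_ofReal (by simpa using hbd w w')
  intro h0
  have himg : Icc (0 : ℝ) 1 ⊆ f '' range g := fun x hx ↦ by
    obtain ⟨w, -, rfl⟩ := ofDigits_SurjOn one_lt_two hx
    exact ⟨g w, mem_range_self w, hfg w⟩
  have h1 := hH.hausdorffMeasure_image_le (by exact_mod_cast ht) zero_le_one
  rw [mul_one, h0, mul_zero, hausdorffMeasure_real] at h1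
  have h2 := (measure_mono himg).trans h1
  simp at h2

end BinaryExpansions

/-- Real numbers which, up to a common shift of scale, lie within `2 ^ (-b k)` of the dyadic
rationals of level `a k`, for every `k`. -/
def dyadicApproxSet (a b : ℕ → ℕ) : Set ℝ :=
  ⋃ C : ℕ, ⋂ k : ℕ, ⋃ p : ℤ,
    Metric.closedBall ((p : ℝ) / 2 ^ (a k + C)) ((2 : ℝ) ^ C / 2 ^ b k)

theorem mem_dyadicApproxSet {a b : ℕ → ℕ} {x : ℝ} : x ∈ dyadicApproxSet a b ↔
    ∃ C : ℕ, ∀ k, ∃ p : ℤ, |x - p / 2 ^ (a k + C)| ≤ (2 : ℝ) ^ C / 2 ^ b k := by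
  simp [dyadicApproxSet, Real.dist_eq]

theorem measurableSet_dyadicApproxSet (a b : ℕ → ℕ) : MeasurableSet (dyadicApproxSet a b) :=
  .iUnion fun _ ↦ .iInter fun _ ↦ .iUnion fun _ ↦ Metric.isClosed_closedBall.measurableSet

theorem exists_abs_sub_div_two_pow_le_of_le {a b C D : ℕ} (hCD : C ≤ D) {x : ℝ}
    (h : ∃ p : ℤ, |x - p / 2 ^ (a + C)| ≤ (2 : ℝ) ^ C / 2 ^ b) :
    ∃ p : ℤ, |x - p / 2 ^ (a + D)| ≤ (2 : ℝ) ^ D / 2 ^ b := by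
  obtain ⟨p, hp⟩ := h
  obtain ⟨e, rfl⟩ := Nat.exists_eq_add_of_le hCD
  refine ⟨p * 2 ^ e, ?_⟩
  have : ((p * 2 ^ e : ℤ) : ℝ) / 2 ^ (a + (C + e)) = p / 2 ^ (a + C) := by
    push_cast
    rw [← add_assoc, pow_add _ (a + C), mul_div_mul_right _ _ (by positivity)]
  rw [this]
  refine hp.trans ?_
  gcongr
  exact one_le_two

theorem midpoint_mem_dyadicApproxSet {a b : ℕ → ℕ} {x y : ℝ} (hx : x ∈ dyadicApproxSet a b)
    (hy : y ∈ dyadicApproxSet a b) : (x + y) / 2 ∈ dyadicApproxSet a b := by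
  rw [mem_dyadicApproxSet] at *
  obtain ⟨C, hC⟩ := hx
  obtain ⟨D, hD⟩ := hy
  refine ⟨max C D + 1, fun k ↦ ?_⟩
  obtain ⟨p, hp⟩ := exists_abs_sub_div_two_pow_le_of_le (le_max_left C D) (hC k)
  obtain ⟨q, hq⟩ := exists_abs_sub_div_two_pow_le_of_le (le_max_right C D) (hD k)
  refine ⟨p + q, ?_⟩
  have h1 : (x + y) / 2 - ((p + q : ℤ) : ℝ) / 2 ^ (a k + (max C D + 1)) =
      ((x - p / 2 ^ (a k + max C D)) + (y - q / 2 ^ (a k + max C D))) / 2 := by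
    push_cast
    rw [← add_assoc, pow_succ]
    field_simp
    ring
  have h2 : (2 : ℝ) ^ (max C D + 1) / 2 ^ b k = 2 * (2 ^ max C D / 2 ^ b k) := by
    rw [pow_succ]
    ring
  have h3 : (0 : ℝ) ≤ 2 ^ max C D / 2 ^ b k := by positivity
  rw [h1, h2]
  rw [abs_le] at *
  constructor <;> linarith

theorem hausdorffMeasure_dyadicApproxSet_eq_zero {a b : ℕ → ℕ} {s : ℝ} (hs : 0 < s)
    (hb : Tendsto b atTop atTop)
    (hab : Tendsto (fun k ↦ (a k : ℝ) - s * b k) atTop atBot) :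
    μH[s] (dyadicApproxSet a b) = 0 := by
  have hsub : dyadicApproxSet a b ⊆ ⋃ C : ℕ, ⋃ N : ℕ,
      {x : ℝ | |x| ≤ N ∧ ∀ k, ∃ p : ℤ, |x - p / 2 ^ (a k + C)| ≤ (2 : ℝ) ^ C / 2 ^ b k} := by
    intro x hx
    obtain ⟨C, hC⟩ := mem_dyadicApproxSet.1 hx
    obtain ⟨N, hN⟩ := exists_nat_ge |x|
    exact mem_iUnion₂.2 ⟨C, N, hN, hC⟩
  refine measure_mono_null hsub (measure_iUnion_null fun C ↦ measure_iUnion_null fun N ↦ ?_)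
  set M : ℕ → ℕ := fun k ↦ 2 ^ (a k + C) * (N + 2 ^ C) with hM
  have hpow : ∀ n : ℕ, ((2 : ℝ) ^ n) = 2 ^ (n : ℝ) := fun n ↦ (Real.rpow_natCast 2 n).symm
  have hdiam : ∀ k (p : ℤ), Metric.ediam (Metric.closedBall ((p : ℝ) / 2 ^ (a k + C))
      ((2 : ℝ) ^ C / 2 ^ b k)) = ENNReal.ofReal (2 * (2 ^ C / 2 ^ b k)) := by
    intro k p
    rw [Real.closedBall_eq_Icc, Real.ediam_Icc]
    congr 1
    ring
  have hr : Tendsto (fun k ↦ ENNReal.ofReal (2 * (2 ^ C / 2 ^ b k))) atTop (𝓝 0) := by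
    rw [← ENNReal.ofReal_zero]
    refine ENNReal.tendsto_ofReal ?_
    have h1 : Tendsto (fun k ↦ ((1 / 2 : ℝ)) ^ b k) atTop (𝓝 0) :=
      (tendsto_pow_atTop_nhds_zero_of_lt_one (by norm_num) (by norm_num)).comp hb
    have h2 := h1.const_mul (2 * 2 ^ C : ℝ)
    rw [mul_zero] at h2
    refine h2.congr fun k ↦ ?_
    rw [one_div, inv_pow]
    ring
  have hle := Measure.hausdorffMeasure_le_liminf_sum (X := ℝ) s
    {x : ℝ | |x| ≤ N ∧ ∀ k, ∃ p : ℤ, |x - p / 2 ^ (a k + C)| ≤ (2 : ℝ) ^ C / 2 ^ b k}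
    _ hr (ι := fun k ↦ ↥(Finset.Icc (-(M k : ℤ)) (M k)))
    (fun k p ↦ Metric.closedBall (((p : ℤ) : ℝ) / 2 ^ (a k + C)) ((2 : ℝ) ^ C / 2 ^ b k))
    (.of_forall fun k p ↦ (hdiam k p).le)
    (.of_forall fun k x ⟨hxN, hx⟩ ↦ by
      obtain ⟨p, hp⟩ := hx k
      have h1 : |(p : ℝ) / 2 ^ (a k + C)| ≤ N + 2 ^ C := by
        have h2 : (2 : ℝ) ^ C / 2 ^ b k ≤ 2 ^ C := div_le_self (by positivity)
          (one_le_pow₀ one_le_two)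
        rw [abs_le] at *
        constructor <;> linarith
      rw [abs_div, abs_of_pos (by positivity : (0 : ℝ) < 2 ^ (a k + C)),
        div_le_iff₀ (by positivity)] at h1
      have h3 : |p| ≤ (M k : ℤ) := by
        rw [hM]
        have : ((|p| : ℤ) : ℝ) ≤ ((2 ^ (a k + C) * (N + 2 ^ C) : ℕ) : ℝ) := by
          push_cast
          linarith
        exact_mod_cast this
      exact mem_iUnion.2 ⟨⟨p, Finset.mem_Icc.2 (abs_le.1 h3)⟩, by
        simpa [Real.dist_eq] using hp⟩)
  refine le_antisymm (hle.trans ?_) zero_le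
  set K : ℝ := 3 * 2 ^ C * (N + 2 ^ C) * (2 * 2 ^ C) ^ s with hK
  have hlim : Tendsto (fun k ↦ ENNReal.ofReal (K * 2 ^ ((a k : ℝ) - s * b k))) atTop (𝓝 0) := by
    rw [← ENNReal.ofReal_zero]
    refine ENNReal.tendsto_ofReal ?_
    have h1 := ((tendsto_rpow_atBot_of_base_gt_one 2 one_lt_two).comp hab).const_mul K
    rwa [mul_zero] at h1
  refine (liminf_le_liminf (.of_forall fun k ↦ ?_)).trans hlim.liminf_eq.le
  simp only [hdiam, Finset.sum_const, Finset.card_univ, Fintype.card_coe, Int.card_Icc, nsmul_eq_mul]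
  have hcard : ((M k : ℤ) + 1 - -(M k : ℤ)).toNat = 2 * M k + 1 := by omega
  rw [hcard, ENNReal.ofReal_rpow_of_nonneg (by positivity) hs.le, ← ENNReal.ofReal_natCast,
    ← ENNReal.ofReal_mul (by positivity)]
  refine ENNReal.ofReal_le_ofReal ?_
  have hM1 : (1 : ℝ) ≤ M k := by
    have : 0 < M k := by positivity
    exact_mod_cast this
  calc ((2 * M k + 1 : ℕ) : ℝ) * (2 * (2 ^ C / 2 ^ b k)) ^ s
      ≤ (3 * M k) * (2 * (2 ^ C / 2 ^ b k)) ^ s := by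
        gcongr
        push_cast
        linarith
    _ = K * 2 ^ ((a k : ℝ) - s * b k) := by
        rw [← mul_div_assoc, Real.div_rpow (by positivity) (by positivity), Real.rpow_sub two_pos,
          hpow (b k), ← Real.rpow_mul zero_le_two, mul_comm (b k : ℝ) s, Real.rpow_natCast 2 (a k),
          hM, hK]
        push_cast
        rw [pow_add]
        ring

theorem ofDigits_mem_dyadicApproxSet {a b : ℕ → ℕ} (hab : ∀ k, a k ≤ b k) {d : ℕ → Fin 2}
    (hd : ∀ k n, a k ≤ n → n < b k → d n = 0) : Real.ofDigits d ∈ dyadicApproxSet a b := by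
  refine mem_dyadicApproxSet.2 ⟨0, fun k ↦ ?_⟩
  refine ⟨∑ i ∈ Finset.range (a k), (d i : ℕ) * 2 ^ (a k - (i + 1)), ?_⟩
  have h1 : ((∑ i ∈ Finset.range (a k), ((d i : ℕ) : ℤ) * 2 ^ (a k - (i + 1)) : ℤ) : ℝ) /
      2 ^ (a k + 0) = ∑ i ∈ Finset.range (a k), Real.ofDigitsTerm d i := by
    push_cast
    rw [Finset.sum_div]
    refine Finset.sum_congr rfl fun i hi ↦ ?_
    have hi := Finset.mem_range.1 hi
    obtain ⟨e, he⟩ := Nat.exists_eq_add_of_le (Nat.succ_le_of_lt hi)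
    rw [Real.ofDigitsTerm, he, add_zero, Nat.succ_eq_add_one, Nat.add_sub_cancel_left, pow_add]
    push_cast
    field_simp
  have h2 : ∑ i ∈ Finset.range (b k), Real.ofDigitsTerm d i =
      ∑ i ∈ Finset.range (a k), Real.ofDigitsTerm d i := by
    refine (Finset.sum_subset (Finset.range_mono (hab k)) fun i hi hi' ↦ ?_).symm
    simp only [Finset.mem_range, not_lt] at hi hi'
    simp [Real.ofDigitsTerm, hd k i hi' hi]
  rw [h1, Real.ofDigits_eq_sum_add_ofDigits d (b k), h2, add_sub_cancel_left, abs_of_nonneg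
    (mul_nonneg (by positivity) (Real.ofDigits_nonneg _)), pow_zero, one_div]
  push_cast
  exact mul_le_of_le_one_right (by positivity) (Real.ofDigits_le_one _)

theorem exists_factorial_add_le_mul_factorial_succ {σ : ℝ} (hσ : 0 < σ) :
    ∃ c : ℝ, ∀ k : ℕ, (k ! : ℝ) + k + 1 - c ≤ σ * (k + 1)! := by
  obtain ⟨M, hM⟩ := exists_nat_ge (3 / σ)
  refine ⟨3 * M !, fun k ↦ ?_⟩
  have hk : (k : ℝ) ≤ k ! := by exact_mod_cast Nat.self_le_factorial k
  have hk1 : (1 : ℝ) ≤ k ! := by exact_mod_cast Nat.one_le_iff_ne_zero.2 (Nat.factorial_ne_zero k)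
  have hM0 : (0 : ℝ) ≤ M ! := by positivity
  have hfac : ((k + 1)! : ℝ) = (k + 1) * k ! := by
    rw [Nat.factorial_succ]
    push_cast
    ring
  rcases le_total k M with hkM | hkM
  · have h1 : (k ! : ℝ) ≤ M ! := by exact_mod_cast Nat.factorial_le hkM
    have h2 : 0 ≤ σ * (k + 1)! := by positivity
    linarith
  · rw [div_le_iff₀ hσ] at hM
    have h1 : (M : ℝ) ≤ k := by exact_mod_cast hkM
    have h2 : 3 ≤ σ * (k + 1) := by nlinarith
    rw [hfac, ← mul_assoc]
    nlinarith

/-- The start of the `k`-th block of vanishing digits, which ends at `(k + 1)!`. -/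
noncomputable def gapStart (s : ℝ) (k : ℕ) : ℕ := ⌊s * (k + 1)!⌋₊ - k

theorem gapStart_le_factorial {s : ℝ} (hs1 : s ≤ 1) (k : ℕ) :
    gapStart s k ≤ (k + 1)! := by
  refine (Nat.sub_le _ _).trans (Nat.floor_le_of_le ?_)
  exact mul_le_of_le_one_left (by positivity) hs1

theorem le_gapStart (s : ℝ) (k : ℕ) : s * (k + 1)! - k - 1 ≤ gapStart s k := by
  have h1 := Nat.lt_floor_add_one (s * (k + 1)!)
  have h2 : (⌊s * (k + 1)!⌋₊ : ℝ) ≤ gapStart s k + k := by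
    rw [gapStart]
    exact_mod_cast le_tsub_add
  linarith

theorem tendsto_gapStart_sub {s : ℝ} (hs0 : 0 < s) (hs1 : s ≤ 1) :
    Tendsto (fun k ↦ (gapStart s k : ℝ) - s * ((k + 1)! : ℕ)) atTop atBot := by
  have h : Tendsto (fun k : ℕ ↦ -(s * (k : ℝ))) atTop atBot :=
    tendsto_neg_atTop_atBot.comp (tendsto_natCast_atTop_atTop.const_mul_atTop hs0)
  refine tendsto_atBot_mono (fun k ↦ ?_) h
  have hk : (k : ℝ) ≤ (k + 1)! := by
    exact_mod_cast (Nat.le_succ k).trans (Nat.self_le_factorial (k + 1))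
  have h0 : (0 : ℝ) ≤ k := k.cast_nonneg
  rcases le_total k ⌊s * (k + 1)!⌋₊ with hle | hle
  · rw [gapStart, Nat.cast_sub hle]
    have := Nat.floor_le (a := s * (k + 1)!) (by positivity)
    nlinarith
  · rw [gapStart, Nat.sub_eq_zero_of_le hle]
    push_cast
    nlinarith

/-- The digit positions outside every block `[gapStart s k, (k + 1)!)` and not congruent
to `-1` modulo `m`. -/
def IsFreePosition (s : ℝ) (m n : ℕ) : Prop :=
  ¬ m ∣ n + 1 ∧ ∀ k, gapStart s k ≤ n → (k + 1)! ≤ n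

open scoped Classical in
theorem exists_sub_le_count_isFreePosition {s t : ℝ} {m : ℕ} (hs1 : s ≤ 1) (ht : 0 < t)
    (htm : t + 1 / m < s) : ∃ c, ∀ n : ℕ, t * n - c ≤ Nat.count (IsFreePosition s m) n := by
  obtain ⟨c, hc⟩ := exists_factorial_add_le_mul_factorial_succ (sub_pos.2 htm)
  have hm0 : (0 : ℝ) ≤ 1 / m := by positivity
  refine ⟨max c 0, fun n ↦ ?_⟩
  have hn0 : (0 : ℝ) ≤ n := n.cast_nonneg
  have hmul : ((n / m : ℕ) : ℝ) ≤ 1 / m * n := by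
    rw [one_div_mul_eq_div]
    exact Nat.cast_div_le
  set F := {i ∈ Finset.range n | IsFreePosition s m i} with hF
  set D := {i ∈ Finset.range n | m ∣ i + 1} with hD
  have hDcard : D.card = n / m := Nat.card_multiples n m
  rw [Nat.count_eq_card_filter_range, ← hF]
  by_cases hex : ∃ k, gapStart s k < n
  · have hfin : {k | gapStart s k < n}.Finite := by
      obtain ⟨N, hN⟩ := exists_nat_ge (n + c)
      refine (finite_Iic N).subset fun k (hk : gapStart s k < n) ↦ ?_
      have h1 := hc k
      have h2 := le_gapStart s k
      have h3 : (k : ℝ) ≤ k ! := by exact_mod_cast Nat.self_le_factorial k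
      have h4 : (gapStart s k : ℝ) < n := by exact_mod_cast hk
      have h5 : 0 ≤ (t + 1 / m) * ((k + 1)! : ℝ) := by positivity
      have : (k : ℝ) ≤ N := by linarith
      exact_mod_cast this
    obtain ⟨k, hk, hmax⟩ := hfin.exists_maximal hex
    have hk : gapStart s k < n := hk
    have hsub : Finset.range n ⊆
        F ∪ (D ∪ (Finset.range k ! ∪ Finset.Ico (gapStart s k) (min (k + 1)! n))) := by
      intro i hi
      have hin := Finset.mem_range.1 hi
      have hiF : i ∈ F ↔ IsFreePosition s m i := by simp [hF, hin]
      have hiD : i ∈ D ↔ m ∣ i + 1 := by simp [hD, hin]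
      simp only [hiF, hiD, Finset.mem_union, Finset.mem_range, Finset.mem_Ico, hin, IsFreePosition,
        lt_min_iff, and_true]
      by_contra! hcon
      obtain ⟨h1, h2, h3, h4⟩ := hcon
      obtain ⟨j, hj1, hj2⟩ := h1 h2
      rcases lt_trichotomy j k with hjk | rfl | hjk
      · exact absurd (Nat.factorial_le (Nat.succ_le_of_lt hjk)) (by
          rw [Nat.succ_eq_add_one]
          omega)
      · exact absurd (h4 hj1) (by omega)
      · exact absurd (hmax (show j ∈ {k | gapStart s k < n} from hj1.trans_lt hin) hjk.le)
          (by simpa using hjk)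
    have hcard := (Finset.card_le_card hsub).trans <| (Finset.card_union_le _ _).trans <|
      Nat.add_le_add_left ((Finset.card_union_le _ _).trans <|
        Nat.add_le_add_left (Finset.card_union_le _ _) _) _
    rw [Finset.card_range, Finset.card_range, Nat.card_Ico, hDcard] at hcard
    have hle : (n : ℝ) ≤ F.card + ((n / m : ℕ) + (k ! + ((min (k + 1)! n : ℕ) - gapStart s k))) := by
      have hb : gapStart s k ≤ min (k + 1)! n := le_min (gapStart_le_factorial hs1 k) hk.le
      have : ((n : ℕ) : ℝ) ≤ ((F.card + (n / m +
        (k ! + (min (k + 1)! n - gapStart s k))) : ℕ) : ℝ) := by exact_mod_cast hcard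
      push_cast [Nat.cast_sub hb] at this ⊢
      exact this
    have hx1 : ((min (k + 1)! n : ℕ) : ℝ) ≤ n := by exact_mod_cast min_le_right _ _
    have hx2 : ((min (k + 1)! n : ℕ) : ℝ) ≤ (k + 1)! := by exact_mod_cast min_le_left _ _
    have h1 := hc k
    have h2 := le_gapStart s k
    have h3 : 0 ≤ (1 - 1 / m - t) * (n - (min (k + 1)! n : ℕ)) :=
      mul_nonneg (by linarith) (by linarith)
    have h4 : 0 ≤ (1 / m + t) * ((k + 1)! - (min (k + 1)! n : ℕ)) :=
      mul_nonneg (by linarith) (by linarith)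
    have h5 := le_max_left c 0
    linarith
  · push Not at hex
    have hsub : Finset.range n ⊆ F ∪ D := by
      intro i hi
      have hin := Finset.mem_range.1 hi
      have hiF : i ∈ F ↔ IsFreePosition s m i := by simp [hF, hin]
      have hiD : i ∈ D ↔ m ∣ i + 1 := by simp [hD, hin]
      simp only [hiF, hiD, Finset.mem_union, IsFreePosition]
      by_contra! hcon
      obtain ⟨j, hj, -⟩ := hcon.1 hcon.2
      have := hex j
      omega
    have hcard := (Finset.card_le_card hsub).trans (Finset.card_union_le _ _)
    rw [Finset.card_range, hDcard] at hcard
    have hle : (n : ℝ) ≤ F.card + (n / m : ℕ) := by exact_mod_cast hcard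
    have h1 := le_max_right c 0
    nlinarith

theorem exists_not_isFreePosition {s : ℝ} {m : ℕ} (hm : 0 < m) (n : ℕ) :
    ∃ p, n < p ∧ p ≤ n + m ∧ ¬ IsFreePosition s m p := by
  have h1 := Nat.lt_mul_div_succ (n + 1) hm
  have h2 := Nat.mul_div_le (n + 1) m
  refine ⟨m * ((n + 1) / m + 1) - 1, by omega, ?_, fun h ↦ h.1 ?_⟩
  · rw [mul_add, mul_one]
    omega
  · rw [Nat.sub_add_cancel (by omega)]
    exact dvd_mul_right _ _

theorem hausdorffMeasure_dyadicApproxSet_gapStart_ne_zero {s t : ℝ} (hs1 : s ≤ 1) (ht : 0 < t)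
    (hts : t < s) : μH[t] (dyadicApproxSet (gapStart s) fun k ↦ (k + 1)!) ≠ 0 := by
  classical
  obtain ⟨m, hm⟩ := exists_nat_one_div_lt (sub_pos.2 hts)
  obtain ⟨c, hc⟩ := exists_sub_le_count_isFreePosition (m := m + 1) hs1 ht (by
    push_cast
    linarith)
  refine fun h0 ↦ hausdorffMeasure_range_ofDigits_spreadDigits_ne_zero ht hc
    (exists_not_isFreePosition m.succ_pos) (measure_mono_null ?_ h0)
  rintro _ ⟨w, rfl⟩
  refine ofDigits_mem_dyadicApproxSet (gapStart_le_factorial hs1) fun k n h1 h2 ↦ if_neg fun h ↦ ?_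
  exact h2.not_ge (h.2 k h1)

theorem Convex.subsingleton_of_hausdorffMeasure_one_eq_zero {E : Set ℝ} (hE : Convex ℝ E)
    (h0 : μH[1] E = 0) : E.Subsingleton := by
  intro x hx y hy
  wlog hxy : x ≤ y generalizing x y
  · exact (this hy hx (le_of_not_ge hxy)).symm
  have h1 : Icc x y ⊆ E := hE.ordConnected.out hx hy
  rw [hausdorffMeasure_real] at h0
  have h2 := measure_mono_null h1 h0
  rw [Real.volume_Icc, ENNReal.ofReal_eq_zero] at h2
  linarith

theorem exists_midpointConvex_not_convex_hausdorffMeasure_zero_dim_s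
    (s : ℝ) (hs0 : 0 < s) (hs1 : s ≤ 1) :
    ∃ E : Set ℝ, MeasurableSet E ∧ dimH E = ENNReal.ofReal s ∧
      (∀ x ∈ E, ∀ y ∈ E, (x + y) / 2 ∈ E) ∧ ¬ Convex ℝ E ∧
      μH[s] E = 0 ∧ ∀ ε : ℝ, 0 < ε → ε < s → μH[s - ε] E = ∞ := by
  set E := dyadicApproxSet (gapStart s) fun k ↦ (k + 1)!
  have hzero : μH[s] E = 0 := by
    refine hausdorffMeasure_dyadicApproxSet_eq_zero hs0 ?_ (tendsto_gapStart_sub hs0 hs1)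
    exact tendsto_atTop_mono (fun k ↦ (Nat.le_succ k).trans (Nat.self_le_factorial (k + 1)))
      tendsto_id
  have htop : ∀ t, 0 < t → t < s → μH[t] E = ∞ := fun t ht hts ↦
    (Measure.hausdorffMeasure_zero_or_top (left_lt_add_div_two.2 hts) E).resolve_left <|
      hausdorffMeasure_dyadicApproxSet_gapStart_ne_zero hs1 (by linarith) (by linarith)
  refine ⟨E, measurableSet_dyadicApproxSet _ _, le_antisymm ?_ ?_,
    fun x hx y hy ↦ midpoint_mem_dyadicApproxSet hx hy, fun hconv ↦ ?_, hzero,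
    fun ε hε hεs ↦ htop _ (by linarith) (by linarith)⟩
  · refine dimH_le_of_hausdorffMeasure_ne_top (d := s.toNNReal) ?_
    rw [Real.coe_toNNReal s hs0.le, hzero]
    exact ENNReal.zero_ne_top
  · refine le_of_forall_lt fun r hr ↦ ?_
    obtain ⟨q, hrq, hqs⟩ := ENNReal.lt_iff_exists_nnreal_btwn.1 hr
    have hq0 : 0 < q := by exact_mod_cast (zero_le).trans_lt hrq
    refine hrq.trans_le (le_dimH_of_hausdorffMeasure_eq_top (htop q (by exact_mod_cast hq0) ?_))
    rwa [← ENNReal.ofReal_coe_nnreal, ENNReal.ofReal_lt_ofReal_iff hs0] at hqs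
  · have hsub := hconv.subsingleton_of_hausdorffMeasure_one_eq_zero
      (le_antisymm ((Measure.hausdorffMeasure_mono hs1 E).trans hzero.le) zero_le)
    have h1 := htop (s / 2) (by linarith) (by linarith)
    have h2 := Measure.hausdorffMeasure_le_one_of_subsingleton hsub (half_pos hs0).le
    rw [h1] at h2
    simp at h2
end
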